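/- arXiv:2211.04030 — 2 statements merged into one kernel-verified Lean document; each statement's English description precedes it below -/
import Mathlib

section
/- Let k be an algebraically closed field of characteristic p > 0, G a finite group, and N a p-subgroup of Z(G). Then the functor M ↦ M/J(kN)M induces an order-preserving bijection between the set of isomorphism classes of basic support τ-tilting kG-modules and the set of isomorphism classes of basic support τ-tilting k(G/N)-modules. -/
/-- A submodule `N ≤ P` is superfluous (small) in `P`. -/
def IsSuperfluous (Λ : Type*) [Ring Λ] {P : Type*} [AddCommGroup P] [Module Λ P]
    (N : Submodule Λ P) : Prop :=
  ∀ K : Submodule Λ P, K ⊔ N = ⊤ → K = ⊤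

/-- `M` is τ-rigid (`Hom_Λ(M, τM) = 0`): for every minimal projective presentation
`P1 →f P0 →g M → 0` (exact with `P0, P1` projective, `g` surjective and both kernels
superfluous), the induced map `Hom_Λ(P0, M) → Hom_Λ(P1, M)`, `h ↦ h ∘ f`, is
surjective.  This is the standard characterization of `Hom_Λ(M, τM) = 0`. -/
def IsTauRigid (Λ : Type*) [Ring Λ] (M : Type*) [AddCommGroup M] [Module Λ M] : Prop :=
  ∀ (P1 P0 : Type) [AddCommGroup P1] [Module Λ P1] [AddCommGroup P0] [Module Λ P0],
    Module.Projective Λ P1 → Module.Projective Λ P0 →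
    ∀ (f : P1 →ₗ[Λ] P0) (g : P0 →ₗ[Λ] M),
      Function.Surjective g → LinearMap.range f = LinearMap.ker g →
      IsSuperfluous Λ (LinearMap.ker g) → IsSuperfluous Λ (LinearMap.ker f) →
      Function.Surjective (fun h : P0 →ₗ[Λ] M => h.comp f)

/-- A module is indecomposable: it is nonzero and admits no nontrivial direct sum
decomposition. -/
def IsIndecomposableModule (Λ : Type*) [Ring Λ] (M : Type*) [AddCommGroup M]
    [Module Λ M] : Prop :=
  Nontrivial M ∧ ∀ A B : Submodule Λ M, IsCompl A B → A = ⊥ ∨ B = ⊥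

/-- `n` is the number of pairwise non-isomorphic indecomposable direct summands `|M|`
of `M`: there is an internal decomposition of `M` into indecomposable submodules, and
`n` is the number of isomorphism classes occurring in it. -/
def HasIndecCount (Λ : Type*) [Ring Λ] (M : Type*) [AddCommGroup M] [Module Λ M]
    (n : ℕ) : Prop :=
  ∃ (t : ℕ) (X : Fin t → Submodule Λ M),
    iSupIndep X ∧ (⨆ i, X i) = ⊤ ∧ (∀ i, IsIndecomposableModule Λ (X i)) ∧
    n = Nat.card (Quot (fun i j : Fin t => Nonempty ((X i) ≃ₗ[Λ] (X j))))

/-- `M` is basic: it decomposes into pairwise non-isomorphic indecomposable direct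
summands. -/
def IsBasicModule (Λ : Type*) [Ring Λ] (M : Type*) [AddCommGroup M] [Module Λ M] :
    Prop :=
  ∃ (t : ℕ) (X : Fin t → Submodule Λ M),
    iSupIndep X ∧ (⨆ i, X i) = ⊤ ∧ (∀ i, IsIndecomposableModule Λ (X i)) ∧
    ∀ i j, i ≠ j → IsEmpty ((X i) ≃ₗ[Λ] (X j))

/-- `M` is a support τ-tilting `Λ`-module: `M` is τ-rigid and there is a (finitely
generated) projective `Λ`-module `P` — realized as a direct summand of a finite free
module — with `Hom_Λ(P, M) = 0` and `|P| + |M| = |Λ|`. -/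
def IsSupportTauTilting (Λ : Type*) [Ring Λ] (M : Type*) [AddCommGroup M]
    [Module Λ M] : Prop :=
  IsTauRigid Λ M ∧
  ∃ (m : ℕ) (P Q : Submodule Λ (Fin m → Λ)),
    IsCompl P Q ∧ (∀ f : P →ₗ[Λ] M, f = 0) ∧
    ∃ nP nM nΛ : ℕ, HasIndecCount Λ P nP ∧ HasIndecCount Λ M nM ∧
      HasIndecCount Λ Λ nΛ ∧ nP + nM = nΛ

/-- The partial order on support τ-tilting modules: `M ≥ N` iff `N` is a quotient of a
finite direct sum of copies of `M`. -/
def STTGe (Λ : Type*) [Ring Λ] (M N : Type*) [AddCommGroup M] [Module Λ M]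
    [AddCommGroup N] [Module Λ N] : Prop :=
  ∃ (t : ℕ) (p : (Fin t → M) →ₗ[Λ] N), Function.Surjective p

/-- `S` is a brick over `Λ` (a `k`-algebra, `k` algebraically closed):
`End_Λ(S) ≅ k`. -/
def IsBrick (k : Type*) [Field k] (Λ : Type*) [Ring Λ] (S : Type*) [AddCommGroup S]
    [Module Λ S] : Prop :=
  Nonempty (Module.End Λ S ≃+* k)

/-- `S` is a semibrick over `Λ`: it is a direct sum of Hom-orthogonal bricks. -/
def IsSemibrick (k : Type*) [Field k] (Λ : Type*) [Ring Λ] (S : Type*)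
    [AddCommGroup S] [Module Λ S] : Prop :=
  ∃ (t : ℕ) (X : Fin t → Submodule Λ S),
    iSupIndep X ∧ (⨆ i, X i) = ⊤ ∧ (∀ i, IsBrick k Λ (X i)) ∧
    ∀ i j, i ≠ j → ∀ f : (X i) →ₗ[Λ] (X j), f = 0

/-- The natural surjection `kG → k(G/N)`. -/
noncomputable def quotMap (k : Type*) [Field k] (G : Type*) [Group G]
    (N : Subgroup G) [N.Normal] :
    MonoidAlgebra k G →+* MonoidAlgebra k (G ⧸ N) :=
  MonoidAlgebra.mapDomainRingHom k (QuotientGroup.mk' N)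

/-- The ideal `J(kN)·kG` of `kG` generated by the Jacobson radical of `kN`. -/
noncomputable def radIdeal (k : Type*) [Field k] (G : Type*) [Group G]
    (N : Subgroup G) : Ideal (MonoidAlgebra k G) :=
  Ideal.span (MonoidAlgebra.mapDomainRingHom k N.subtype ''
    (((⊥ : Ideal (MonoidAlgebra k ↥N)).jacobson : Ideal (MonoidAlgebra k ↥N)) :
      Set (MonoidAlgebra k ↥N)))

/-- The correspondence `M ↦ M/J(kN)M`: the `k(G/N)`-module `M'`, viewed as a
`kG`-module by restriction of scalars along `kG → k(G/N)`, is isomorphic to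
`M/J(kN)M`. -/
noncomputable def sttRel (k : Type*) [Field k] (G : Type*) [Group G]
    (N : Subgroup G) [N.Normal] (M : ModuleCat (MonoidAlgebra k G))
    (M' : ModuleCat (MonoidAlgebra k (G ⧸ N))) : Prop :=
  Nonempty ((((ModuleCat.restrictScalars (quotMap k G N)).obj M' :
        ModuleCat (MonoidAlgebra k G)) : Type _) ≃ₗ[MonoidAlgebra k G]
      ((M : Type _) ⧸
        (radIdeal k G N • (⊤ : Submodule (MonoidAlgebra k G) M))))

section Reduction

universe u

/-- The surjection `π : A → B` is the reduction modulo the ideal of `A` generated by a nilpotent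
ideal `m` of the center of `A`. -/
structure IsCentralReduction {A B : Type*} [Ring A] [Ring B] (π : A →+* B)
    (m : Ideal (Subring.center A)) : Prop where
  surj : Function.Surjective π
  fg : m.FG
  nil : IsNilpotent m
  ker : ∀ a : A, π a = 0 ↔ a ∈ m • (⊤ : Submodule (Subring.center A) A)

/-- The semilinear map `q : M → M'` identifies `M'` with `M / mM`. -/
structure IsModReduction {A B : Type*} [Ring A] [Ring B] {π : A →+* B}
    (m : Ideal (Subring.center A)) {M M' : Type*} [AddCommGroup M] [Module A M]
    [AddCommGroup M'] [Module B M'] (q : M →ₛₗ[π] M') : Prop where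
  surj : Function.Surjective q
  ker : ∀ x : M, q x = 0 ↔ x ∈ m • (⊤ : Submodule (Subring.center A) M)

section Nakayama

variable {R M : Type*} [CommRing R] [AddCommGroup M] [Module R M] {m : Ideal R}

theorem Submodule.eq_top_of_sup_smul_top_of_isNilpotent (hm : IsNilpotent m) {S : Submodule R M}
    (h : S ⊔ m • ⊤ = ⊤) : S = ⊤ := by
  have key : ∀ n : ℕ, S ⊔ (m ^ n) • ⊤ = ⊤ := by
    intro n
    induction n with
    | zero => simp
    | succ n ih =>
      rw [eq_top_iff]
      calc (⊤ : Submodule R M) = S ⊔ m ^ n • (S ⊔ m • ⊤) := by rw [h, ih]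
        _ ≤ S ⊔ m ^ (n + 1) • ⊤ := by
          rw [Submodule.smul_sup, pow_succ, Submodule.mul_smul]
          exact sup_le le_sup_left
            (sup_le (Submodule.smul_le_right.trans le_sup_left) le_sup_right)
  obtain ⟨n, hn⟩ := hm
  have := key n
  rw [hn] at this
  simpa using this

end Nakayama

variable {A B : Type*} [Ring A] [Ring B] {π : A →+* B} {m : Ideal (Subring.center A)}

section

variable {M N : Type*} [AddCommGroup M] [Module A M] [AddCommGroup N] [Module A N]

theorem LinearMap.map_mem_center_smul_top (f : M →ₗ[A] N) {x : M}
    (hx : x ∈ m • (⊤ : Submodule (Subring.center A) M)) :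
    f x ∈ m • (⊤ : Submodule (Subring.center A) N) := by
  have h : Submodule.map (f.restrictScalars (Subring.center A)) (m • ⊤) ≤ m • ⊤ := by
    rw [Submodule.map_smul'']
    exact Submodule.smul_mono le_rfl le_top
  exact h ⟨x, hx, rfl⟩

theorem mem_center_smul_top_of_injective_of_retract {f : M →ₗ[A] N} {g : N →ₗ[A] M}
    (hfg : ∀ x, g (f x) = x) {x : M}
    (hx : f x ∈ m • (⊤ : Submodule (Subring.center A) N)) :
    x ∈ m • (⊤ : Submodule (Subring.center A) M) := by
  have := g.map_mem_center_smul_top hx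
  rwa [hfg] at this

theorem mem_center_smul_top_pi_iff {ι : Type*} [Finite ι] {Y : ι → Type*}
    [∀ i, AddCommGroup (Y i)] [∀ i, Module A (Y i)] {x : ∀ i, Y i} :
    x ∈ m • (⊤ : Submodule (Subring.center A) (∀ i, Y i)) ↔
      ∀ i, x i ∈ m • (⊤ : Submodule (Subring.center A) (Y i)) := by
  classical
  cases nonempty_fintype ι
  constructor
  · intro h i
    exact (LinearMap.proj (R := A) i).map_mem_center_smul_top h
  · intro h
    have : x = ∑ i, LinearMap.single A Y i (x i) := by
      simp [LinearMap.single_apply, Finset.univ_sum_single]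
    rw [this]
    exact Submodule.sum_mem _ fun i _ => (LinearMap.single A Y i).map_mem_center_smul_top (h i)

/-- Surjectivity can be checked modulo a nilpotent central ideal. -/
theorem LinearMap.surjective_of_center_reduction (hm : IsNilpotent m) (f : M →ₗ[A] N)
    (h : ∀ y, ∃ x, y - f x ∈ m • (⊤ : Submodule (Subring.center A) N)) :
    Function.Surjective f := by
  have : LinearMap.range (f.restrictScalars (Subring.center A)) = ⊤ := by
    apply Submodule.eq_top_of_sup_smul_top_of_isNilpotent hm
    rw [eq_top_iff]
    intro y _
    obtain ⟨x, hx⟩ := h y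
    rw [← sub_add_cancel y (f x), add_comm]
    exact Submodule.add_mem_sup ⟨x, rfl⟩ hx
  intro y
  have hy : y ∈ LinearMap.range (f.restrictScalars (Subring.center A)) := by
    rw [this]; trivial
  exact hy

/-- A map from a projective module into `mM` lies in `m Hom(P, M)`. -/
theorem mem_smul_top_hom_of_forall_mem {P : Type*} [AddCommGroup P] [Module A P]
    [Module.Projective A P] (hm : m.FG) (h : P →ₗ[A] M)
    (hh : ∀ x, h x ∈ m • (⊤ : Submodule (Subring.center A) M)) :
    h ∈ m • (⊤ : Submodule (Subring.center A) (P →ₗ[A] M)) := by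
  classical
  obtain ⟨s, hs⟩ := hm
  let σ : (s → M) →ₗ[A] M := ∑ z : s, (z : Subring.center A) • LinearMap.proj z
  have hσ : ∀ x, σ x = ∑ z : s, (z : Subring.center A) • x z := by
    intro x; simp [σ, LinearMap.sum_apply]
  have hrange : ∀ y ∈ m • (⊤ : Submodule (Subring.center A) M), y ∈ LinearMap.range σ := by
    intro y hy
    refine (Submodule.smul_le (P := (LinearMap.range σ).restrictScalars (Subring.center A))).2
      (fun c hc x _ => ?_) hy
    rw [← hs] at hc
    induction hc using Submodule.span_induction with
    | mem z hz =>
      refine ⟨Pi.single ⟨z, hz⟩ x, ?_⟩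
      rw [hσ, Finset.sum_eq_single ⟨z, hz⟩]
      · simp
      · intro b _ hb
        rw [Pi.single_eq_of_ne hb, smul_zero]
      · simp
    | zero => rw [zero_smul]; exact Submodule.zero_mem _
    | add c d _ _ hc hd => rw [add_smul]; exact Submodule.add_mem _ hc hd
    | smul c d _ hd => rw [smul_assoc]; exact Submodule.smul_mem _ _ hd
  obtain ⟨φ, hφ⟩ := Module.projective_lifting_property σ.rangeRestrict
    (h.codRestrict (LinearMap.range σ) fun x => hrange _ (hh x)) σ.surjective_rangeRestrict
  have : h = ∑ z : s, (z : Subring.center A) • (LinearMap.proj z ∘ₗ φ) := by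
    ext x
    have h1 := congrArg Subtype.val (LinearMap.congr_fun hφ x)
    simp only [LinearMap.comp_apply, LinearMap.codRestrict_apply, LinearMap.rangeRestrict]
      at h1
    rw [← h1, hσ]
    simp [LinearMap.sum_apply]
  rw [this]
  refine Submodule.sum_mem _ fun z _ => Submodule.smul_mem_smul ?_ trivial
  rw [← hs]
  exact Submodule.subset_span z.2

theorem comp_mem_smul_top_hom {P Q : Type*} [AddCommGroup P] [Module A P] [AddCommGroup Q]
    [Module A Q] {f : P →ₗ[A] Q}
    (hf : Function.Surjective fun h : Q →ₗ[A] M => h.comp f) {h : P →ₗ[A] M}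
    (hh : h ∈ m • (⊤ : Submodule (Subring.center A) (P →ₗ[A] M))) :
    ∃ u ∈ m • (⊤ : Submodule (Subring.center A) (Q →ₗ[A] M)), u.comp f = h := by
  let Φ : (Q →ₗ[A] M) →ₗ[Subring.center A] (P →ₗ[A] M) :=
    { toFun := fun h => h.comp f
      map_add' := fun _ _ => rfl
      map_smul' := fun _ _ => rfl }
  have : Submodule.map Φ (m • ⊤) = m • ⊤ := by
    rw [Submodule.map_smul'', Submodule.map_top, LinearMap.range_eq_top.2 hf]
  rw [← this] at hh
  obtain ⟨u, hu, rfl⟩ := hh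
  exact ⟨u, hu, rfl⟩

theorem apply_mem_of_mem_smul_top_hom {h : M →ₗ[A] N}
    (hh : h ∈ m • (⊤ : Submodule (Subring.center A) (M →ₗ[A] N))) (x : M) :
    h x ∈ m • (⊤ : Submodule (Subring.center A) N) := by
  let Φ : (M →ₗ[A] N) →ₗ[Subring.center A] N :=
    { toFun := fun h => h x
      map_add' := fun _ _ => rfl
      map_smul' := fun _ _ => rfl }
  have h1 : Submodule.map Φ (m • ⊤) ≤ m • ⊤ := by
    rw [Submodule.map_smul'']
    exact Submodule.smul_mono le_rfl le_top
  exact h1 ⟨h, hh, rfl⟩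

end

/-- Semilinear maps out of a projective module lift along surjective semilinear maps. -/
theorem exists_lift_of_projective {P M M' : Type*} [AddCommGroup P] [Module A P]
    [Module.Projective A P] [AddCommGroup M] [Module A M] [AddCommGroup M'] [Module B M']
    {q : M →ₛₗ[π] M'} (hq : Function.Surjective q) (h : P →ₛₗ[π] M') :
    ∃ φ : P →ₗ[A] M, ∀ x, q (φ x) = h x := by
  let _ : Module A M' := Module.compHom M' π
  let q₁ : M →ₗ[A] M' := { toFun := q, map_add' := map_add q, map_smul' := map_smulₛₗ q }
  let h₁ : P →ₗ[A] M' := { toFun := h, map_add' := map_add h, map_smul' := map_smulₛₗ h }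
  obtain ⟨φ, hφ⟩ := Module.projective_lifting_property q₁ h₁ hq
  exact ⟨φ, fun x => LinearMap.congr_fun hφ x⟩

namespace IsCentralReduction

variable (hπ : IsCentralReduction π m)

section

variable {M M' N N' : Type*} [AddCommGroup M] [Module A M] [AddCommGroup M'] [Module B M']
  [AddCommGroup N] [Module A N] [AddCommGroup N'] [Module B N']
include hπ

theorem isModReduction_toSemilinear : IsModReduction m π.toSemilinearMap :=
  ⟨hπ.surj, hπ.ker⟩

theorem map_center_eq_zero {c : Subring.center A} (hc : c ∈ m) : π c = 0 := by
  rw [hπ.ker]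
  have := Submodule.smul_mem_smul hc
    (Submodule.mem_top : (1 : A) ∈ (⊤ : Submodule (Subring.center A) A))
  rwa [Subring.smul_def, smul_eq_mul, mul_one] at this

theorem map_eq_zero (q : M →ₛₗ[π] M') {x : M}
    (hx : x ∈ m • (⊤ : Submodule (Subring.center A) M)) : q x = 0 := by
  induction hx using Submodule.smul_induction_on' with
  | smul c hc x _ =>
    rw [Subring.smul_def, map_smulₛₗ, hπ.map_center_eq_zero hc, zero_smul]
  | add x _ y _ hx hy => rw [map_add, hx, hy, add_zero]

theorem smul_mem_of_map_eq_zero {a : A} (ha : π a = 0) (x : M) :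
    a • x ∈ m • (⊤ : Submodule (Subring.center A) M) :=
  (LinearMap.toSpanSingleton A M x).map_mem_center_smul_top ((hπ.ker a).1 ha)

/-- A semilinear map out of `M` factors through its reduction. -/
theorem exists_descend {q : M →ₛₗ[π] M'} (hq : IsModReduction m q) (h : M →ₛₗ[π] N') :
    ∃ h' : M' →ₗ[B] N', ∀ x, h' (q x) = h x := by
  have key : ∀ x y, q x = q y → h x = h y := by
    intro x y hxy
    rw [← sub_eq_zero, ← map_sub] at hxy ⊢
    exact hπ.map_eq_zero h ((hq.ker _).1 hxy)
  have hs : ∀ x, h (Function.surjInv hq.surj (q x)) = h x := fun x =>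
    key _ _ (Function.surjInv_eq hq.surj _)
  refine ⟨{ toFun := fun y => h (Function.surjInv hq.surj y), map_add' := ?_, map_smul' := ?_ },
    hs⟩
  · intro x y
    obtain ⟨x, rfl⟩ := hq.surj x
    obtain ⟨y, rfl⟩ := hq.surj y
    rw [← map_add, hs, hs, hs, map_add]
  · intro b x
    obtain ⟨x, rfl⟩ := hq.surj x
    obtain ⟨b, rfl⟩ := hπ.surj b
    rw [← map_smulₛₗ, hs, hs, map_smulₛₗ]
    rfl

theorem exists_reduce {q : M →ₛₗ[π] M'} (hq : IsModReduction m q) (q₂ : N →ₛₗ[π] N')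
    (f : M →ₗ[A] N) : ∃ f' : M' →ₗ[B] N', ∀ x, f' (q x) = q₂ (f x) :=
  hπ.exists_descend hq (q₂.comp f)

end

include hπ in
/-- Every module has a reduction. -/
theorem exists_isModReduction (M : Type u) [AddCommGroup M] [Module A M] :
    ∃ (M' : Type u) (_ : AddCommGroup M') (_ : Module B M') (q : M →ₛₗ[π] M'),
      IsModReduction m q := by
  let K : Submodule A M :=
    { (m • (⊤ : Submodule (Subring.center A) M)) with
      smul_mem' := fun a x hx => by
        induction hx using Submodule.smul_induction_on' with
        | smul c hc x _ =>
          rw [smul_comm]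
          exact Submodule.smul_mem_smul hc Submodule.mem_top
        | add x _ y _ hx hy => rw [smul_add]; exact Submodule.add_mem _ hx hy }
  have hK : ∀ x, x ∈ K ↔ x ∈ m • (⊤ : Submodule (Subring.center A) M) := fun _ => Iff.rfl
  let _ : SMul B (M ⧸ K) := ⟨fun b x => Function.surjInv hπ.surj b • x⟩
  have hsmul : ∀ (a : A) (x : M ⧸ K), π a • x = a • x := by
    intro a x
    obtain ⟨x, rfl⟩ := K.mkQ_surjective x
    change Function.surjInv hπ.surj (π a) • K.mkQ x = a • K.mkQ x
    rw [← sub_eq_zero, ← sub_smul, ← map_smul, Submodule.mkQ_apply,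
      Submodule.Quotient.mk_eq_zero, hK]
    apply hπ.smul_mem_of_map_eq_zero
    rw [map_sub, Function.surjInv_eq hπ.surj, sub_self]
  let inst : Module B (M ⧸ K) := Function.Surjective.moduleLeft π hπ.surj hsmul
  refine ⟨M ⧸ K, inferInstance, inst,
    { toFun := K.mkQ, map_add' := map_add _, map_smul' := fun a x => ?_ },
    K.mkQ_surjective, fun x => ?_⟩
  · rw [map_smul]
    exact (hsmul a _).symm
  · change K.mkQ x = 0 ↔ _
    rw [Submodule.mkQ_apply, Submodule.Quotient.mk_eq_zero, hK]

end IsCentralReduction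

end Reduction

section TauOrthogonal

theorem IsSuperfluous.bijective_of_range_sup {A Q : Type*} [Ring A] [AddCommGroup Q] [Module A Q]
    [Module.Projective A Q] {L : Submodule A Q} (hL : IsSuperfluous A L) (c : Q →ₗ[A] Q)
    (hrange : LinearMap.range c ⊔ L = ⊤) (hker : LinearMap.ker c ≤ L) :
    Function.Bijective c := by
  have hsurj : Function.Surjective c := LinearMap.range_eq_top.1 (hL _ hrange)
  obtain ⟨s, hs⟩ := Module.projective_lifting_property c LinearMap.id hsurj
  have hs' : ∀ x, c (s x) = x := fun x => LinearMap.congr_fun hs x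
  have htop : LinearMap.range s = ⊤ := by
    apply hL
    rw [eq_top_iff]
    intro x _
    rw [← add_sub_cancel (s (c x)) x]
    refine Submodule.add_mem_sup ⟨_, rfl⟩ (hker ?_)
    rw [LinearMap.mem_ker, map_sub, hs', sub_self]
  refine ⟨(injective_iff_map_eq_zero c).2 fun x hx => ?_, hsurj⟩
  obtain ⟨y, rfl⟩ := LinearMap.range_eq_top.1 htop x
  rw [hs'] at hx
  rw [hx, map_zero]

theorem exists_lift_of_forall_mem_range {A Q P M : Type*} [Ring A] [AddCommGroup Q] [Module A Q]
    [Module.Projective A Q] [AddCommGroup P] [Module A P] [AddCommGroup M] [Module A M]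
    (f : P →ₗ[A] M) (h : Q →ₗ[A] M) (hh : ∀ x, h x ∈ LinearMap.range f) :
    ∃ φ : Q →ₗ[A] P, ∀ x, f (φ x) = h x := by
  obtain ⟨φ, hφ⟩ := Module.projective_lifting_property f.rangeRestrict
    (h.codRestrict (LinearMap.range f) hh) f.surjective_rangeRestrict
  exact ⟨φ, fun x => congrArg Subtype.val (LinearMap.congr_fun hφ x)⟩

/-- If the presentation `f` of `M` satisfies `Hom(N, τM) = 0`, then so does every minimal
presentation of a direct summand `Y` of `M`. -/
theorem surjective_comp_of_retract {A P₁ P₀ Q₁ Q₀ M Y N : Type*} [Ring A]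
    [AddCommGroup P₁] [Module A P₁] [AddCommGroup P₀] [Module A P₀]
    [AddCommGroup Q₁] [Module A Q₁] [AddCommGroup Q₀] [Module A Q₀]
    [AddCommGroup M] [Module A M] [AddCommGroup Y] [Module A Y] [AddCommGroup N] [Module A N]
    [Module.Projective A P₁] [Module.Projective A P₀]
    [Module.Projective A Q₁] [Module.Projective A Q₀]
    {f : P₁ →ₗ[A] P₀} {g : P₀ →ₗ[A] M} {f' : Q₁ →ₗ[A] Q₀} {g' : Q₀ →ₗ[A] Y}
    (hg : Function.Surjective g) (hfg : LinearMap.range f = LinearMap.ker g)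
    (hg' : Function.Surjective g') (hfg' : LinearMap.range f' = LinearMap.ker g')
    (hsg : IsSuperfluous A (LinearMap.ker g')) (hsf : IsSuperfluous A (LinearMap.ker f'))
    {ι : Y →ₗ[A] M} {ρ : M →ₗ[A] Y} (hρι : ∀ y, ρ (ι y) = y)
    (hN : Function.Surjective fun h : P₀ →ₗ[A] N => h.comp f) :
    Function.Surjective fun h : Q₀ →ₗ[A] N => h.comp f' := by
  have hgf : ∀ x, g (f x) = 0 := fun x => by
    rw [← LinearMap.mem_ker, ← hfg]; exact ⟨x, rfl⟩
  have hgf' : ∀ x, g' (f' x) = 0 := fun x => by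
    rw [← LinearMap.mem_ker, ← hfg']; exact ⟨x, rfl⟩
  obtain ⟨α₀, hα₀⟩ := exists_lift_of_forall_mem_range g (ι.comp g') fun x => hg _
  obtain ⟨β₀, hβ₀⟩ := exists_lift_of_forall_mem_range g' (ρ.comp g) fun x => hg' _
  simp only [LinearMap.comp_apply] at hα₀ hβ₀
  obtain ⟨α₁, hα₁⟩ := exists_lift_of_forall_mem_range f (α₀.comp f') fun x => by
    rw [hfg, LinearMap.mem_ker, LinearMap.comp_apply, hα₀, hgf', map_zero]
  obtain ⟨β₁, hβ₁⟩ := exists_lift_of_forall_mem_range f' (β₀.comp f) fun x => by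
    rw [hfg', LinearMap.mem_ker, LinearMap.comp_apply, hβ₀, hgf, map_zero]
  simp only [LinearMap.comp_apply] at hα₁ hβ₁
  have hc₀g : ∀ x, g' (β₀ (α₀ x)) = g' x := fun x => by rw [hβ₀, hα₀, hρι]
  have hc₁f : ∀ x, f' (β₁ (α₁ x)) = β₀ (α₀ (f' x)) := fun x => by rw [hβ₁, hα₁]
  have hc₀ : Function.Bijective (β₀.comp α₀) := by
    apply hsg.bijective_of_range_sup
    · rw [eq_top_iff]
      intro x _
      rw [← add_sub_cancel (β₀ (α₀ x)) x]
      refine Submodule.add_mem_sup ⟨_, rfl⟩ ?_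
      rw [LinearMap.mem_ker, map_sub, hc₀g, sub_self]
    · intro x hx
      rw [LinearMap.mem_ker] at hx ⊢
      rw [← hc₀g, ← LinearMap.comp_apply β₀, hx, map_zero]
  have hc₁ : Function.Bijective (β₁.comp α₁) := by
    apply hsf.bijective_of_range_sup
    · rw [eq_top_iff]
      intro x _
      obtain ⟨w, hw⟩ := hc₀.2 (f' x)
      rw [LinearMap.comp_apply] at hw
      obtain ⟨y, rfl⟩ : w ∈ LinearMap.range f' := by
        rw [hfg', LinearMap.mem_ker, ← hc₀g, hw, hgf']
      rw [← add_sub_cancel (β₁ (α₁ y)) x]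
      refine Submodule.add_mem_sup ⟨_, rfl⟩ ?_
      rw [LinearMap.mem_ker, map_sub, hc₁f, hw, sub_self]
    · intro x hx
      rw [LinearMap.mem_ker] at hx ⊢
      apply hc₀.1
      rw [map_zero, LinearMap.comp_apply, ← hc₁f, ← LinearMap.comp_apply β₁, hx, map_zero]
  intro h
  obtain ⟨u, hu⟩ := hN (h.comp β₁)
  have hu' : ∀ x, u (f x) = h (β₁ x) := fun x => LinearMap.congr_fun hu x
  let e := LinearEquiv.ofBijective _ hc₀
  refine ⟨(u.comp α₀).comp e.symm.toLinearMap, LinearMap.ext fun y => ?_⟩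
  obtain ⟨z, rfl⟩ := hc₁.2 y
  have he : e.symm (f' (β₁ (α₁ z))) = f' z := by
    rw [LinearEquiv.symm_apply_eq, hc₁f]; rfl
  simp only [LinearMap.comp_apply, LinearEquiv.coe_coe]
  rw [he, ← hα₁, hu']

/-- Finitely generated modules over an Artinian ring have projective covers. -/
theorem exists_projectiveCover (A : Type) [Ring A] [IsArtinianRing A] (M : Type*)
    [AddCommGroup M] [Module A M] [Module.Finite A M] :
    ∃ (P : Type) (_ : AddCommGroup P) (_ : Module A P) (g : P →ₗ[A] M),
      Module.Finite A P ∧ Module.Projective A P ∧ Function.Surjective g ∧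
      IsSuperfluous A (LinearMap.ker g) := by
  obtain ⟨n, f, hf⟩ := Module.Finite.exists_fin' A M
  let S : Set (Submodule A (Fin n → A)) :=
    {Q | (∃ p : (Fin n → A) →ₗ[A] Q, ∀ x : Q, p x = x) ∧ Q.map f = ⊤}
  obtain ⟨Q, ⟨⟨p, hp⟩, hQ⟩, hmin⟩ := IsArtinian.set_has_minimal S
    ⟨⊤, ⟨LinearMap.id.codRestrict ⊤ fun _ => trivial, fun _ => rfl⟩,
      by rw [Submodule.map_top, LinearMap.range_eq_top.2 hf]⟩
  have hproj : Module.Projective A Q :=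
    Module.Projective.of_split Q.subtype p (LinearMap.ext hp)
  have hg : Function.Surjective (f.comp Q.subtype) := by
    rw [← LinearMap.range_eq_top, LinearMap.range_comp, Submodule.range_subtype, hQ]
  refine ⟨Q, inferInstance, inferInstance, f.comp Q.subtype, inferInstance, hproj, hg,
    fun K hK => ?_⟩
  set g := f.comp Q.subtype with hgdef
  have hgK : Function.Surjective (g.comp K.subtype) := by
    rw [← LinearMap.range_eq_top, LinearMap.range_comp, Submodule.range_subtype, eq_top_iff]
    intro y _
    obtain ⟨x, rfl⟩ := hg y
    obtain ⟨a, ha, b, hb, rfl⟩ := Submodule.mem_sup.1 (hK ▸ Submodule.mem_top : x ∈ K ⊔ _)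
    exact ⟨a, ha, by rw [map_add, LinearMap.mem_ker.1 hb, add_zero]⟩
  obtain ⟨φ₀, hφ₀⟩ := exists_lift_of_forall_mem_range (g.comp K.subtype) g fun x => hgK _
  let φ : Module.End A Q := K.subtype.comp φ₀
  have hφ : ∀ x, g (φ x) = g x := hφ₀
  obtain ⟨N, hN, hN1⟩ := (φ.eventually_isCompl_ker_pow_range_pow.and
    (Filter.eventually_ge_atTop 1)).exists
  have hφN : ∀ j x, g ((φ ^ j) x) = g x := by
    intro j
    induction j with
    | zero => intro x; simp
    | succ j ih => intro x; rw [pow_succ, Module.End.mul_apply, ih, hφ]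
  let R := (LinearMap.range (φ ^ N)).map Q.subtype
  have hRQ : R ≤ Q := Submodule.map_subtype_le _ _
  have hRS : R ∈ S := by
    constructor
    · let r := (LinearMap.range (φ ^ N)).projectionOnto _ hN.symm
      refine ⟨((Q.subtype.comp (Submodule.subtype _)).comp (r.comp p)).codRestrict R
        fun x => ⟨_, (r (p x)).2, rfl⟩, ?_⟩
      rintro ⟨x, y, hy, rfl⟩
      apply Subtype.ext
      have : r (p (Q.subtype y)) = ⟨y, hy⟩ := by
        rw [Submodule.subtype_apply, hp]
        exact Submodule.projectionOnto_apply_left hN.symm ⟨y, hy⟩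
      exact congrArg (fun z : LinearMap.range (φ ^ N) => ((z : Q) : Fin n → A)) this
    · rw [eq_top_iff]
      intro y _
      obtain ⟨x, rfl⟩ := hg y
      exact ⟨_, ⟨(φ ^ N) x, ⟨x, rfl⟩, rfl⟩, hφN N x⟩
  have hRQ' : R = Q := eq_of_le_of_not_lt hRQ (hmin R hRS)
  rw [eq_top_iff]
  intro x _
  have hx : (x : Fin n → A) ∈ R := hRQ'.ge x.2
  obtain ⟨_, ⟨y, rfl⟩, hy⟩ := hx
  have : x = (φ ^ N) y := Subtype.ext hy.symm
  obtain ⟨j, hj⟩ := Nat.exists_eq_add_of_le hN1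
  rw [this, hj, pow_add, pow_one, Module.End.mul_apply]
  exact (φ₀ _).2

/-- Finitely generated modules over an Artinian ring have minimal projective presentations. -/
theorem exists_minimalPresentation (A : Type) [Ring A] [IsArtinianRing A] (M : Type*)
    [AddCommGroup M] [Module A M] [Module.Finite A M] :
    ∃ (P₁ P₀ : Type) (_ : AddCommGroup P₁) (_ : Module A P₁) (_ : AddCommGroup P₀)
      (_ : Module A P₀) (f : P₁ →ₗ[A] P₀) (g : P₀ →ₗ[A] M),
      Module.Finite A P₁ ∧ Module.Projective A P₁ ∧
      Module.Finite A P₀ ∧ Module.Projective A P₀ ∧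
      Function.Surjective g ∧ LinearMap.range f = LinearMap.ker g ∧
      IsSuperfluous A (LinearMap.ker g) ∧ IsSuperfluous A (LinearMap.ker f) := by
  obtain ⟨P₀, _, _, g, hf₀, hp₀, hg, hgs⟩ := exists_projectiveCover A M
  obtain ⟨P₁, _, _, f, hf₁, hp₁, hf, hfs⟩ := exists_projectiveCover A (LinearMap.ker g)
  refine ⟨P₁, P₀, _, _, _, _, (LinearMap.ker g).subtype.comp f, g, hf₁, hp₁, hf₀, hp₀, hg,
    ?_, hgs, ?_⟩
  · rw [LinearMap.range_comp, LinearMap.range_eq_top.2 hf, Submodule.map_top,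
      Submodule.range_subtype]
  · rwa [LinearMap.ker_comp_of_ker_eq_bot _ (Submodule.ker_subtype _)]

/-- `M` has a projective presentation `P₁ → P₀ → M → 0` with `Hom(P₀, N) → Hom(P₁, N)`
surjective; that is, `Hom(N, τM) = 0`. -/
def IsTauOrthogonal (A : Type) [Ring A] (M N : Type*) [AddCommGroup M] [Module A M]
    [AddCommGroup N] [Module A N] : Prop :=
  ∃ (P₁ P₀ : Type) (_ : AddCommGroup P₁) (_ : Module A P₁) (_ : AddCommGroup P₀)
    (_ : Module A P₀) (f : P₁ →ₗ[A] P₀) (g : P₀ →ₗ[A] M),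
    Module.Finite A P₁ ∧ Module.Projective A P₁ ∧
    Module.Finite A P₀ ∧ Module.Projective A P₀ ∧
    Function.Surjective g ∧ LinearMap.range f = LinearMap.ker g ∧
    Function.Surjective fun h : P₀ →ₗ[A] N => h.comp f

section

variable {A : Type} [Ring A] {M N Y : Type*} [AddCommGroup M] [Module A M]
  [AddCommGroup N] [Module A N] [AddCommGroup Y] [Module A Y]

theorem IsTauOrthogonal.isTauRigid (h : IsTauOrthogonal A M M) : IsTauRigid A M := by
  obtain ⟨P₁, P₀, _, _, _, _, f, g, _, _, _, _, hg, hfg, hN⟩ := h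
  intro Q₁ Q₀ _ _ _ _ _ _ f' g' hg' hfg' hsg hsf
  exact surjective_comp_of_retract hg hfg hg' hfg' hsg hsf
    (ι := LinearMap.id) (ρ := LinearMap.id) (fun _ => rfl) hN

theorem IsTauRigid.isTauOrthogonal [IsArtinianRing A] [Module.Finite A M]
    (h : IsTauRigid A M) : IsTauOrthogonal A M M := by
  obtain ⟨P₁, P₀, _, _, _, _, f, g, h₁, h₂, h₃, h₄, hg, hfg, hsg, hsf⟩ :=
    exists_minimalPresentation A M
  exact ⟨P₁, P₀, _, _, _, _, f, g, h₁, h₂, h₃, h₄, hg, hfg,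
    h P₁ P₀ h₂ h₄ f g hg hfg hsg hsf⟩

theorem IsTauOrthogonal.of_retract [IsArtinianRing A] [Module.Finite A M]
    (h : IsTauOrthogonal A M N) {ι : Y →ₗ[A] M} {ρ : M →ₗ[A] Y} (hρι : ∀ y, ρ (ι y) = y) :
    IsTauOrthogonal A Y N := by
  obtain ⟨P₁, P₀, _, _, _, _, f, g, _, _, _, _, hg, hfg, hN⟩ := h
  have : Module.Finite A Y := Module.Finite.of_surjective ρ fun y => ⟨_, hρι y⟩
  obtain ⟨Q₁, Q₀, _, _, _, _, f', g', h₁, h₂, h₃, h₄, hg', hfg', hsg, hsf⟩ :=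
    exists_minimalPresentation A Y
  exact ⟨Q₁, Q₀, _, _, _, _, f', g', h₁, h₂, h₃, h₄, hg', hfg',
    surjective_comp_of_retract hg hfg hg' hfg' hsg hsf hρι hN⟩

theorem surjective_comp_of_surjective_pi {P₁ P₀ : Type*} [AddCommGroup P₁] [Module A P₁]
    [AddCommGroup P₀] [Module A P₀] [Module.Projective A P₁] {f : P₁ →ₗ[A] P₀}
    (hN : Function.Surjective fun h : P₀ →ₗ[A] N => h.comp f) {t : ℕ}
    {p : (Fin t → N) →ₗ[A] Y} (hp : Function.Surjective p) :
    Function.Surjective fun h : P₀ →ₗ[A] Y => h.comp f := by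
  intro h
  obtain ⟨φ, hφ⟩ := exists_lift_of_forall_mem_range p h fun x => hp _
  choose u hu using fun i => hN ((LinearMap.proj i).comp φ)
  refine ⟨p.comp (LinearMap.pi u), LinearMap.ext fun x => ?_⟩
  simp only [LinearMap.comp_apply]
  rw [← hφ]
  congr 1
  ext i
  exact LinearMap.congr_fun (hu i) x

theorem STTGe.of_surjective {p : N →ₗ[A] Y} (hp : Function.Surjective p) : STTGe A N Y :=
  ⟨1, p.comp (LinearMap.proj 0), fun y => by
    obtain ⟨x, rfl⟩ := hp y
    exact ⟨fun _ => x, rfl⟩⟩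

theorem IsTauOrthogonal.of_sttGe (h : IsTauOrthogonal A M N) (hNY : STTGe A N Y) :
    IsTauOrthogonal A M Y := by
  obtain ⟨P₁, P₀, _, _, _, _, f, g, h₁, h₂, h₃, h₄, hg, hfg, hN⟩ := h
  obtain ⟨t, p, hp⟩ := hNY
  exact ⟨P₁, P₀, _, _, _, _, f, g, h₁, h₂, h₃, h₄, hg, hfg,
    surjective_comp_of_surjective_pi hN hp⟩

theorem IsTauOrthogonal.of_projective {P : Type} [AddCommGroup P] [Module A P]
    [Module.Finite A P] [Module.Projective A P] : IsTauOrthogonal A P N :=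
  ⟨PUnit, P, _, _, _, _, 0, LinearMap.id, inferInstance, inferInstance, inferInstance,
    inferInstance, Function.surjective_id, by simp, fun h => ⟨0, Subsingleton.elim _ _⟩⟩

end

end TauOrthogonal

section Transfer

universe w

theorem exists_factor_of_surjective {A P M N : Type*} [Ring A] [AddCommGroup P] [Module A P]
    [AddCommGroup M] [Module A M] [AddCommGroup N] [Module A N] {g : P →ₗ[A] M}
    (hg : Function.Surjective g) (ψ : P →ₗ[A] N) (h : ∀ x, g x = 0 → ψ x = 0) :
    ∃ φ : M →ₗ[A] N, ∀ x, φ (g x) = ψ x := by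
  refine ⟨((LinearMap.ker g).liftQ ψ fun x hx => h x hx).comp
    (g.quotKerEquivOfSurjective hg).symm.toLinearMap, fun x => ?_⟩
  have : (g.quotKerEquivOfSurjective hg).symm (g x) = Submodule.Quotient.mk x := by
    rw [LinearEquiv.symm_apply_eq]; rfl
  simp only [LinearMap.comp_apply, LinearEquiv.coe_coe]
  rw [this]
  rfl

theorem exists_mem_smul_top_of_surjective {A P M : Type*} [Ring A] [AddCommGroup P] [Module A P]
    [AddCommGroup M] [Module A M] {m : Ideal (Subring.center A)} {g : P →ₗ[A] M}
    (hg : Function.Surjective g) {y : M}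
    (hy : y ∈ m • (⊤ : Submodule (Subring.center A) M)) :
    ∃ x ∈ m • (⊤ : Submodule (Subring.center A) P), g x = y := by
  have : Submodule.map (g.restrictScalars (Subring.center A)) (m • ⊤) = m • ⊤ := by
    rw [Submodule.map_smul'', Submodule.map_top,
      (LinearMap.range_eq_top (f := g.restrictScalars (Subring.center A))).2 hg]
  rw [← this] at hy
  exact hy

namespace IsModReduction

variable {A B : Type*} [Ring A] [Ring B] {π : A →+* B} {m : Ideal (Subring.center A)}
  {M M' N N' : Type*} [AddCommGroup M] [Module A M] [AddCommGroup M'] [Module B M']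
  [AddCommGroup N] [Module A N] [AddCommGroup N'] [Module B N']

theorem comp_equiv {q : M →ₛₗ[π] M'} (hq : IsModReduction m q) (e : N ≃ₗ[A] M) :
    IsModReduction m (q.comp e.toLinearMap) := by
  refine ⟨hq.surj.comp e.surjective, fun x => ?_⟩
  rw [LinearMap.comp_apply, hq.ker]
  exact ⟨fun h => mem_center_smul_top_of_injective_of_retract
      (f := e.toLinearMap) (g := e.symm.toLinearMap) (fun x => e.symm_apply_apply x) h,
    fun h => e.toLinearMap.map_mem_center_smul_top h⟩

theorem equiv_comp {q : M →ₛₗ[π] M'} (hq : IsModReduction m q) (e : M' ≃ₗ[B] N') :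
    IsModReduction m (e.toLinearMap.comp q) := by
  refine ⟨e.surjective.comp hq.surj, fun x => ?_⟩
  rw [← hq.ker, LinearMap.comp_apply, LinearEquiv.coe_coe, e.map_eq_zero_iff]

theorem pi {ι : Type*} [Finite ι] {Y Y' : ι → Type*} [∀ i, AddCommGroup (Y i)]
    [∀ i, Module A (Y i)] [∀ i, AddCommGroup (Y' i)] [∀ i, Module B (Y' i)]
    {q : ∀ i, Y i →ₛₗ[π] Y' i} (hq : ∀ i, IsModReduction m (q i)) :
    IsModReduction m
      ({ toFun := fun x i => q i (x i)
         map_add' := fun _ _ => funext fun i => map_add (q i) _ _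
         map_smul' := fun _ _ => funext fun i => map_smulₛₗ (q i) _ _ } :
        (∀ i, Y i) →ₛₗ[π] (∀ i, Y' i)) := by
  refine ⟨fun y => ?_, fun x => ?_⟩
  · choose x hx using fun i => (hq i).surj (y i)
    exact ⟨x, funext hx⟩
  · rw [mem_center_smul_top_pi_iff]
    simp only [← (hq _).ker]
    exact funext_iff

theorem finite {q : M →ₛₗ[π] M'} (hq : IsModReduction m q) (hπ : IsCentralReduction π m)
    [Module.Finite A M] : Module.Finite B M' :=
  have : RingHomSurjective π := ⟨hπ.surj⟩
  Module.Finite.of_surjective q hq.surj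

theorem surjective_of_surjective {q : M →ₛₗ[π] M'} {q₂ : N →ₛₗ[π] N'}
    (hq : IsModReduction m q) (hq₂ : IsModReduction m q₂) (hπ : IsCentralReduction π m)
    {φ : M →ₗ[A] N} {φ' : M' →ₗ[B] N'} (h : ∀ x, q₂ (φ x) = φ' (q x))
    (hφ' : Function.Surjective φ') : Function.Surjective φ := by
  apply φ.surjective_of_center_reduction hπ.nil
  intro y
  obtain ⟨x', hx'⟩ := hφ' (q₂ y)
  obtain ⟨x, rfl⟩ := hq.surj x'
  exact ⟨x, by rw [← hq₂.ker, map_sub, h, hx', sub_self]⟩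

theorem nontrivial_iff {q : M →ₛₗ[π] M'} (hq : IsModReduction m q)
    (hπ : IsCentralReduction π m) : Nontrivial M' ↔ Nontrivial M := by
  refine ⟨fun _ => hq.surj.nontrivial, fun hM => ?_⟩
  by_contra hM'
  rw [not_nontrivial_iff_subsingleton] at hM'
  have := (0 : PUnit →ₗ[A] M).surjective_of_center_reduction hπ.nil fun y => ⟨0, by
    rw [← hq.ker]; exact Subsingleton.elim _ _⟩
  exact not_subsingleton M this.subsingleton

theorem projective {q : M →ₛₗ[π] M'} (hq : IsModReduction m q) (hπ : IsCentralReduction π m)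
    [Module.Projective A M] : Module.Projective B M' := by
  apply Module.Projective.of_lifting_property''
  intro f hf
  have hπ1 : ∀ b : M' →₀ B, ∃ a : M' →₀ A, a.mapRange π (map_zero π) = b :=
    Finsupp.mapRange_surjective π (map_zero π) hπ.surj
  let σ : (M' →₀ A) →ₛₗ[π] (M' →₀ B) :=
    { toFun := fun a => a.mapRange π (map_zero π)
      map_add' := fun a b => by ext; simp
      map_smul' := fun a b => by ext; simp }
  obtain ⟨φ, hφ⟩ := exists_lift_of_projective (q := f.comp σ) (hf.comp hπ1) q
  obtain ⟨s, hs⟩ := hπ.exists_descend hq (σ.comp φ)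
  refine ⟨s, LinearMap.ext fun y => ?_⟩
  obtain ⟨x, rfl⟩ := hq.surj y
  rw [LinearMap.comp_apply, hs]
  exact hφ x

/-- `Hom(P, M)` vanishes if and only if its reduction does. -/
theorem hom_eq_zero_iff {q : M →ₛₗ[π] M'} {q₂ : N →ₛₗ[π] N'}
    (hq : IsModReduction m q) (hq₂ : IsModReduction m q₂) (hπ : IsCentralReduction π m)
    [Module.Projective A M] : (∀ f : M' →ₗ[B] N', f = 0) ↔ (∀ f : M →ₗ[A] N, f = 0) := by
  constructor
  · intro h f
    have key : (⊥ : Submodule (Subring.center A) (M →ₗ[A] N)) = ⊤ := by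
      apply Submodule.eq_top_of_sup_smul_top_of_isNilpotent hπ.nil
      rw [bot_sup_eq, eq_top_iff]
      intro f _
      apply mem_smul_top_hom_of_forall_mem hπ.fg
      intro x
      obtain ⟨f', hf'⟩ := hπ.exists_reduce hq q₂ f
      rw [← hq₂.ker, ← hf', h f', LinearMap.zero_apply]
    have : f ∈ (⊥ : Submodule (Subring.center A) (M →ₗ[A] N)) := key ▸ Submodule.mem_top
    exact (Submodule.mem_bot _).1 this
  · intro h f'
    obtain ⟨f, hf⟩ := exists_lift_of_projective hq₂.surj (f'.comp q)
    refine LinearMap.ext fun y => ?_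
    obtain ⟨x, rfl⟩ := hq.surj y
    have := hf x
    rw [h f, LinearMap.zero_apply, map_zero] at this
    exact this.symm

end IsModReduction

section Presentation

variable {A B : Type*} [Ring A] [Ring B] {π : A →+* B} {m : Ideal (Subring.center A)}
  {P₁ P₁' P₀ P₀' N N' : Type*} [AddCommGroup P₁] [Module A P₁] [AddCommGroup P₁'] [Module B P₁']
  [AddCommGroup P₀] [Module A P₀] [AddCommGroup P₀'] [Module B P₀']
  [AddCommGroup N] [Module A N] [AddCommGroup N'] [Module B N']

theorem surjective_comp_reduce (hπ : IsCentralReduction π m) [Module.Projective A P₁]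
    {q₁ : P₁ →ₛₗ[π] P₁'} (hq₁ : IsModReduction m q₁) {q₀ : P₀ →ₛₗ[π] P₀'}
    (hq₀ : IsModReduction m q₀) {q : N →ₛₗ[π] N'} (hq : IsModReduction m q)
    {f : P₁ →ₗ[A] P₀} {f' : P₁' →ₗ[B] P₀'} (hf : ∀ x, f' (q₁ x) = q₀ (f x))
    (h : Function.Surjective fun h : P₀ →ₗ[A] N => h.comp f) :
    Function.Surjective fun h : P₀' →ₗ[B] N' => h.comp f' := by
  intro h'
  obtain ⟨φ, hφ⟩ := exists_lift_of_projective hq.surj (h'.comp q₁)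
  obtain ⟨u, hu⟩ := h φ
  obtain ⟨u', hu'⟩ := hπ.exists_reduce hq₀ q u
  refine ⟨u', LinearMap.ext fun y => ?_⟩
  obtain ⟨x, rfl⟩ := hq₁.surj y
  have : u (f x) = φ x := LinearMap.congr_fun hu x
  rw [LinearMap.comp_apply, hf, hu', this]
  exact hφ x

theorem surjective_comp_of_reduce (hπ : IsCentralReduction π m) [Module.Projective A P₁]
    [Module.Projective A P₀]
    {q₁ : P₁ →ₛₗ[π] P₁'} (hq₁ : IsModReduction m q₁) (q₀ : P₀ →ₛₗ[π] P₀')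
    {q : N →ₛₗ[π] N'} (hq : IsModReduction m q)
    {f : P₁ →ₗ[A] P₀} {f' : P₁' →ₗ[B] P₀'} (hf : ∀ x, f' (q₁ x) = q₀ (f x))
    (h : Function.Surjective fun h : P₀' →ₗ[B] N' => h.comp f') :
    Function.Surjective fun h : P₀ →ₗ[A] N => h.comp f := by
  let Φ : (P₀ →ₗ[A] N) →ₗ[Subring.center A] (P₁ →ₗ[A] N) :=
    { toFun := fun h => h.comp f
      map_add' := fun _ _ => rfl
      map_smul' := fun _ _ => rfl }
  suffices LinearMap.range Φ = ⊤ from LinearMap.range_eq_top.1 this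
  apply Submodule.eq_top_of_sup_smul_top_of_isNilpotent hπ.nil
  rw [eq_top_iff]
  intro φ _
  obtain ⟨φ', hφ'⟩ := hπ.exists_reduce hq₁ q φ
  obtain ⟨u', hu'⟩ := h φ'
  obtain ⟨u, hu⟩ := exists_lift_of_projective hq.surj (u'.comp q₀)
  rw [← add_sub_cancel (Φ u) φ]
  refine Submodule.add_mem_sup ⟨u, rfl⟩ (mem_smul_top_hom_of_forall_mem hπ.fg _ fun x => ?_)
  have h1 : u' (f' (q₁ x)) = φ' (q₁ x) := LinearMap.congr_fun hu' _
  have h2 : q (u (f x)) = u' (q₀ (f x)) := hu _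
  have h3 : Φ u x = u (f x) := rfl
  rw [← hq.ker, LinearMap.sub_apply, map_sub, h3, h2, ← hf, h1, hφ', sub_self]

end Presentation

variable {A B : Type} [Ring A] [Ring B] {π : A →+* B} {m : Ideal (Subring.center A)}
  {M M' N N' X X' : Type*} [AddCommGroup M] [Module A M] [AddCommGroup M'] [Module B M']
  [AddCommGroup N] [Module A N] [AddCommGroup N'] [Module B N']
  [AddCommGroup X] [Module A X] [AddCommGroup X'] [Module B X']

theorem IsTauOrthogonal.reduce (h : IsTauOrthogonal A M N) (hπ : IsCentralReduction π m)
    {q : M →ₛₗ[π] M'} (hq : IsModReduction m q) {q₂ : N →ₛₗ[π] N'} (hq₂ : IsModReduction m q₂) :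
    IsTauOrthogonal B M' N' := by
  obtain ⟨P₁, P₀, _, _, _, _, f, g, _, _, _, _, hg, hfg, hN⟩ := h
  obtain ⟨P₁', _, _, q₁, hq₁⟩ := hπ.exists_isModReduction P₁
  obtain ⟨P₀', _, _, q₀, hq₀⟩ := hπ.exists_isModReduction P₀
  obtain ⟨f', hf'⟩ := hπ.exists_reduce hq₁ q₀ f
  obtain ⟨g', hg'⟩ := hπ.exists_reduce hq₀ q g
  refine ⟨P₁', P₀', _, _, _, _, f', g', hq₁.finite hπ, hq₁.projective hπ, hq₀.finite hπ,
    hq₀.projective hπ, ?_, ?_, surjective_comp_reduce hπ hq₁ hq₀ hq₂ hf' hN⟩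
  · intro y
    obtain ⟨x, rfl⟩ := hq.surj y
    obtain ⟨z, rfl⟩ := hg x
    exact ⟨q₀ z, hg' z⟩
  · apply le_antisymm
    · rintro _ ⟨y, rfl⟩
      obtain ⟨x, rfl⟩ := hq₁.surj y
      have : f x ∈ LinearMap.ker g := hfg ▸ ⟨x, rfl⟩
      rw [LinearMap.mem_ker, hf', hg', LinearMap.mem_ker.1 this, map_zero]
    · intro y hy
      obtain ⟨x, rfl⟩ := hq₀.surj y
      rw [LinearMap.mem_ker, hg', hq.ker] at hy
      obtain ⟨x', hx', hxx'⟩ := exists_mem_smul_top_of_surjective hg hy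
      have : x - x' ∈ LinearMap.range f := by
        rw [hfg, LinearMap.mem_ker, map_sub, hxx', sub_self]
      obtain ⟨z, hz⟩ := this
      refine ⟨q₁ z, ?_⟩
      rw [hf', hz, map_sub, (hq₀.ker x').2 hx', sub_zero]

theorem IsTauOrthogonal.of_sttGe_reduce (h : IsTauOrthogonal A M X)
    (hπ : IsCentralReduction π m) {q : X →ₛₗ[π] X'} (hq : IsModReduction m q)
    {q₂ : N →ₛₗ[π] N'} (hq₂ : IsModReduction m q₂) (hXN : STTGe B X' N') :
    IsTauOrthogonal A M N := by
  obtain ⟨P₁, P₀, _, _, _, _, f, g, h₁, h₂, h₃, h₄, hg, hfg, hN⟩ := h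
  obtain ⟨P₁', _, _, q₁, hq₁⟩ := hπ.exists_isModReduction P₁
  obtain ⟨P₀', _, _, q₀, hq₀⟩ := hπ.exists_isModReduction P₀
  obtain ⟨f', hf'⟩ := hπ.exists_reduce hq₁ q₀ f
  have : Module.Projective B P₁' := hq₁.projective hπ
  obtain ⟨t, p, hp⟩ := hXN
  exact ⟨P₁, P₀, _, _, _, _, f, g, h₁, h₂, h₃, h₄, hg, hfg,
    surjective_comp_of_reduce hπ hq₁ q₀ hq₂ hf'
      (surjective_comp_of_surjective_pi (surjective_comp_reduce hπ hq₁ hq₀ hq hf' hN) hp)⟩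

theorem IsTauOrthogonal.exists_lift (h : IsTauOrthogonal A M N) (hπ : IsCentralReduction π m)
    (q : M →ₛₗ[π] M') {q₂ : N →ₛₗ[π] N'} (hq₂ : IsModReduction m q₂)
    (φ' : M' →ₗ[B] N') : ∃ φ : M →ₗ[A] N, ∀ x, q₂ (φ x) = φ' (q x) := by
  obtain ⟨P₁, P₀, _, _, _, _, f, g, _, _, _, _, hg, hfg, hN⟩ := h
  have hgf : ∀ x, g (f x) = 0 := fun x => by
    rw [← LinearMap.mem_ker, ← hfg]; exact ⟨x, rfl⟩
  obtain ⟨φ₀, hφ₀⟩ := exists_lift_of_projective hq₂.surj ((φ'.comp q).comp g)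
  have h1 : φ₀.comp f ∈ m • (⊤ : Submodule (Subring.center A) (P₁ →ₗ[A] N)) := by
    apply mem_smul_top_hom_of_forall_mem hπ.fg
    intro x
    rw [← hq₂.ker, LinearMap.comp_apply, hφ₀, LinearMap.comp_apply, hgf, map_zero]
  obtain ⟨u, hu, huf⟩ := comp_mem_smul_top_hom hN h1
  obtain ⟨φ, hφ⟩ := exists_factor_of_surjective hg (φ₀ - u) fun x hx => by
    obtain ⟨y, rfl⟩ : x ∈ LinearMap.range f := by rwa [hfg]
    rw [LinearMap.sub_apply, ← LinearMap.comp_apply u, huf, LinearMap.comp_apply, sub_self]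
  refine ⟨φ, fun x => ?_⟩
  obtain ⟨z, rfl⟩ := hg x
  rw [hφ, LinearMap.sub_apply, map_sub, hφ₀,
    (hq₂.ker _).2 (apply_mem_of_mem_smul_top_hom hu z), sub_zero]
  rfl

/-- A finitely generated projective module lifts along a central reduction. -/
theorem exists_projective_lift (hπ : IsCentralReduction π m) [IsArtinianRing A]
    [Module.Finite B M'] [Module.Projective B M'] :
    ∃ (P : Type) (_ : AddCommGroup P) (_ : Module A P) (q : P →ₛₗ[π] M'),
      Module.Finite A P ∧ Module.Projective A P ∧ IsModReduction m q := by
  let _ : Module A M' := Module.compHom M' π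
  let id' : M' →ₛₗ[π] M' := { toFun := id, map_add' := fun _ _ => rfl, map_smul' := fun _ _ => rfl }
  have : Module.Finite A M' := by
    obtain ⟨s, hs⟩ := (inferInstance : Module.Finite B M')
    refine ⟨s, ?_⟩
    rw [eq_top_iff]
    intro x _
    have hx : x ∈ Submodule.span B (s : Set M') := hs ▸ Submodule.mem_top
    induction hx using Submodule.span_induction with
    | mem x hx => exact Submodule.subset_span hx
    | zero => exact Submodule.zero_mem _
    | add x y _ _ hx hy => exact Submodule.add_mem _ (hx trivial) (hy trivial)
    | smul b x _ hx =>
      obtain ⟨a, rfl⟩ := hπ.surj b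
      exact Submodule.smul_mem _ a (hx trivial)
  obtain ⟨P, _, _, g, hf, hp, hg, hgs⟩ := exists_projectiveCover A M'
  obtain ⟨P', _, _, q, hq⟩ := hπ.exists_isModReduction P
  obtain ⟨g', hg'⟩ := hπ.exists_descend hq (id'.comp g)
  replace hg' : ∀ x, g' (q x) = g x := hg'
  obtain ⟨s, hs⟩ := Module.projective_lifting_property g' LinearMap.id
    fun y => by
      obtain ⟨x, rfl⟩ := hg y
      exact ⟨q x, hg' x⟩
  have hs' : ∀ y, g' (s y) = y := fun y => LinearMap.congr_fun hs y
  have htop : (LinearMap.range s).comap q = ⊤ := by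
    apply hgs
    rw [eq_top_iff]
    intro x _
    obtain ⟨z, hz⟩ := hq.surj (s (g x))
    rw [← add_sub_cancel z x]
    refine Submodule.add_mem_sup ⟨g x, hz.symm⟩ ?_
    rw [LinearMap.mem_ker, map_sub, ← hg' z, hz, hs', sub_self]
  refine ⟨P, _, _, id'.comp g, hf, hp, hg, fun x => ?_⟩
  rw [← hq.ker]
  change g x = 0 ↔ _
  obtain ⟨y, hy⟩ : x ∈ (LinearMap.range s).comap q := htop ▸ Submodule.mem_top
  rw [← hg', ← hy, hs']
  constructor
  · rintro rfl
    exact map_zero s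
  · intro h
    rw [← hs' y, h, map_zero]

/-- A module over the reduction lifts compatibly with τ-orthogonality. -/
theorem IsTauOrthogonal.exists_module_lift [IsArtinianRing A] (h : IsTauOrthogonal B M' N')
    (hπ : IsCentralReduction π m) :
    ∃ (X : Type) (_ : AddCommGroup X) (_ : Module A X) (q : X →ₛₗ[π] M'),
      Module.Finite A X ∧ IsModReduction m q ∧
      ∀ (N : Type w) [AddCommGroup N] [Module A N] (q₂ : N →ₛₗ[π] N'),
        IsModReduction m q₂ → IsTauOrthogonal A X N := by
  obtain ⟨P₁', P₀', _, _, _, _, f', g', _, _, _, _, hg', hfg', hN⟩ := h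
  obtain ⟨P₁, _, _, q₁, hf₁, hp₁, hq₁⟩ := exists_projective_lift (M' := P₁') hπ
  obtain ⟨P₀, _, _, q₀, hf₀, hp₀, hq₀⟩ := exists_projective_lift (M' := P₀') hπ
  obtain ⟨f, hf⟩ := exists_lift_of_projective hq₀.surj (f'.comp q₁)
  replace hf : ∀ x, f' (q₁ x) = q₀ (f x) := fun x => (hf x).symm
  have hgf' : ∀ x, g' (f' x) = 0 := fun x => by
    rw [← LinearMap.mem_ker, ← hfg']; exact ⟨x, rfl⟩
  let g := (LinearMap.range f).mkQ
  have hg : Function.Surjective g := Submodule.mkQ_surjective _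
  have hgf : ∀ x, g (f x) = 0 := fun x => by
    rw [Submodule.mkQ_apply, Submodule.Quotient.mk_eq_zero]
    exact ⟨x, rfl⟩
  let q : (P₀ ⧸ LinearMap.range f) →ₛₗ[π] M' := (LinearMap.range f).liftQ (g'.comp q₀) (by
    rintro _ ⟨x, rfl⟩
    rw [LinearMap.mem_ker, LinearMap.comp_apply, ← hf, hgf'])
  have hqg : ∀ x, q (g x) = g' (q₀ x) := fun x => rfl
  have hq : IsModReduction m q := by
    refine ⟨fun y => ?_, fun x => ⟨fun hx => ?_, hπ.map_eq_zero q⟩⟩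
    · obtain ⟨z, rfl⟩ := hg' y
      obtain ⟨x, rfl⟩ := hq₀.surj z
      exact ⟨g x, hqg x⟩
    · obtain ⟨x, rfl⟩ := hg x
      rw [hqg] at hx
      obtain ⟨y', hy'⟩ : q₀ x ∈ LinearMap.range f' := by rwa [hfg', LinearMap.mem_ker]
      obtain ⟨y, rfl⟩ := hq₁.surj y'
      have : g x = g (x - f y) := by rw [map_sub, hgf, sub_zero]
      rw [this]
      apply g.map_mem_center_smul_top
      rw [← hq₀.ker, map_sub, ← hf, hy', sub_self]
  refine ⟨P₀ ⧸ LinearMap.range f, _, _, q, inferInstance, hq, fun N _ _ q₂ hq₂ =>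
    ⟨P₁, P₀, _, _, _, _, f, g, hf₁, hp₁, hf₀, hp₀, hg, (Submodule.ker_mkQ _).symm,
      surjective_comp_of_reduce hπ hq₁ q₀ hq₂ hf hN⟩⟩

theorem LinearMap.bijective_of_surjective_of_surjective {A M N : Type*} [Ring A]
    [IsNoetherianRing A] [AddCommGroup M] [Module A M] [AddCommGroup N] [Module A N]
    [Module.Finite A M] {φ : M →ₗ[A] N} {ψ : N →ₗ[A] M}
    (hφ : Function.Surjective φ) (hψ : Function.Surjective ψ) :
    Function.Bijective φ := by
  refine ⟨?_, hφ⟩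
  have h : Function.Injective (ψ.comp φ) :=
    IsNoetherian.injective_of_surjective_endomorphism _ (hψ.comp hφ)
  exact Function.Injective.of_comp h

end Transfer

section Decomposition

theorem LinearEquiv.isIndecomposableModule {A M N : Type*} [Ring A] [AddCommGroup M] [Module A M]
    [AddCommGroup N] [Module A N] (e : M ≃ₗ[A] N) (h : IsIndecomposableModule A M) :
    IsIndecomposableModule A N := by
  have := h.1
  refine ⟨e.symm.toEquiv.nontrivial, fun X Y hXY => ?_⟩
  let o := Submodule.orderIsoMapComap e.symm
  have := h.2 (o X) (o Y) (o.isCompl_iff.1 hXY)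
  rwa [map_eq_bot_iff, map_eq_bot_iff] at this

theorem isIndecomposableModule_iff {A M : Type*} [Ring A] [AddCommGroup M] [Module A M] :
    IsIndecomposableModule A M ↔
      Nontrivial M ∧ ∀ e : Module.End A M, IsIdempotentElem e → e = 0 ∨ e = 1 := by
  refine and_congr_right fun _ => ⟨fun h e he => ?_, fun h X Y hXY => ?_⟩
  · rcases h _ _ (LinearMap.IsIdempotentElem.isCompl he) with h | h
    · exact Or.inl (LinearMap.range_eq_bot.1 h)
    · refine Or.inr (LinearMap.ext fun x => ?_)
      have h1 : e (e x - x) = 0 := by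
        rw [map_sub, ← Module.End.mul_apply, he.eq, sub_self]
      exact sub_eq_zero.1 (LinearMap.ker_eq_bot'.1 h _ h1)
  · rcases h _ (Submodule.isIdempotentElem_projection hXY) with h | h
    · refine Or.inl ((Submodule.eq_bot_iff _).2 fun x hx => ?_)
      have := Submodule.projection_apply_of_mem_left hXY hx
      rw [← this, h, LinearMap.zero_apply]
    · refine Or.inr ((Submodule.eq_bot_iff _).2 fun x hx => ?_)
      have := Submodule.projection_apply_of_mem_right hXY hx
      rwa [h] at this

/-- `M` is a direct sum of `t` indecomposable submodules, whose pairs of isomorphic members are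
given by the relation `p`. -/
def HasDecomposition (A M : Type*) [Ring A] [AddCommGroup M] [Module A M] (t : ℕ)
    (p : Fin t → Fin t → Prop) : Prop :=
  ∃ X : Fin t → Submodule A M, iSupIndep X ∧ (⨆ i, X i) = ⊤ ∧
    (∀ i, IsIndecomposableModule A (X i)) ∧ ∀ i j, Nonempty (X i ≃ₗ[A] X j) ↔ p i j

section

variable {A M N : Type*} [Ring A] [AddCommGroup M] [Module A M] [AddCommGroup N] [Module A N]

theorem hasIndecCount_iff {n : ℕ} :
    HasIndecCount A M n ↔ ∃ t p, HasDecomposition A M t p ∧ n = Nat.card (Quot p) := by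
  constructor
  · rintro ⟨t, X, h₁, h₂, h₃, h₄⟩
    exact ⟨t, _, ⟨X, h₁, h₂, h₃, fun i j => Iff.rfl⟩, h₄⟩
  · rintro ⟨t, p, ⟨X, h₁, h₂, h₃, h₄⟩, hn⟩
    obtain rfl : (fun i j => Nonempty (X i ≃ₗ[A] X j)) = p := by
      ext i j
      exact h₄ i j
    exact ⟨t, X, h₁, h₂, h₃, hn⟩

theorem isBasicModule_iff :
    IsBasicModule A M ↔ ∃ t p, HasDecomposition A M t p ∧ ∀ i j, i ≠ j → ¬ p i j := by
  constructor
  · rintro ⟨t, X, h₁, h₂, h₃, h₄⟩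
    exact ⟨t, _, ⟨X, h₁, h₂, h₃, fun i j => Iff.rfl⟩, fun i j hij =>
      not_nonempty_iff.2 (h₄ i j hij)⟩
  · rintro ⟨t, p, ⟨X, h₁, h₂, h₃, h₄⟩, hp⟩
    refine ⟨t, X, h₁, h₂, h₃, fun i j hij => not_nonempty_iff.1 fun h => ?_⟩
    exact hp i j hij ((h₄ i j).1 h)

theorem HasDecomposition.of_equiv_pi {t : ℕ} {p : Fin t → Fin t → Prop} {Y : Fin t → Type*}
    [∀ i, AddCommGroup (Y i)] [∀ i, Module A (Y i)] (e : M ≃ₗ[A] ∀ i, Y i)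
    (hY : ∀ i, IsIndecomposableModule A (Y i))
    (hp : ∀ i j, Nonempty (Y i ≃ₗ[A] Y j) ↔ p i j) : HasDecomposition A M t p := by
  let s (i : Fin t) : Y i →ₗ[A] M := e.symm.toLinearMap.comp (LinearMap.single A Y i)
  have hs : ∀ i, Function.Injective (s i) := fun i =>
    e.symm.injective.comp (Pi.single_injective i)
  let c (i : Fin t) : Y i ≃ₗ[A] LinearMap.range (s i) := LinearEquiv.ofInjective (s i) (hs i)
  refine ⟨fun i => LinearMap.range (s i), fun i => ?_, ?_,
    fun i => (c i).isIndecomposableModule (hY i), fun i j => ?_⟩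
  · rw [Submodule.disjoint_def]
    rintro _ ⟨y, rfl⟩ hy
    have hle : (⨆ j, ⨆ (_ : j ≠ i), LinearMap.range (s j)) ≤
        LinearMap.ker ((LinearMap.proj i).comp e.toLinearMap) := by
      refine iSup₂_le fun j hj => ?_
      rintro _ ⟨z, rfl⟩
      simp [s, hj.symm]
    have := hle hy
    have hy0 : y = 0 := by simpa [s] using this
    rw [hy0, map_zero]
  · rw [eq_top_iff]
    intro x _
    have hx : x = ∑ i, s i (e x i) := by
      apply e.injective
      rw [map_sum]
      simp only [s, LinearMap.comp_apply, LinearEquiv.coe_coe, LinearEquiv.apply_symm_apply,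
        LinearMap.single_apply]
      exact (Finset.univ_sum_single (e x)).symm
    rw [hx]
    exact Submodule.sum_mem _ fun i _ => Submodule.mem_iSup_of_mem i ⟨_, rfl⟩
  · rw [← hp]
    exact ⟨fun ⟨f⟩ => ⟨(c i).trans (f.trans (c j).symm)⟩,
      fun ⟨f⟩ => ⟨(c i).symm.trans (f.trans (c j))⟩⟩

theorem HasDecomposition.exists_equiv_pi {t : ℕ} {p : Fin t → Fin t → Prop}
    (h : HasDecomposition A M t p) :
    ∃ X : Fin t → Submodule A M, (∀ i, IsIndecomposableModule A (X i)) ∧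
      (∀ i j, Nonempty (X i ≃ₗ[A] X j) ↔ p i j) ∧ Nonempty (M ≃ₗ[A] ∀ i, X i) := by
  obtain ⟨X, h₁, h₂, h₃, h₄⟩ := h
  exact ⟨X, h₃, h₄, ⟨(h₁.linearEquiv h₂).symm.trans (DFinsupp.linearEquivFunOnFintype (R := A))⟩⟩

end

section Endomorphism

variable {A B : Type*} [Ring A] [Ring B] {π : A →+* B} {m : Ideal (Subring.center A)}
  {M M' : Type*} [AddCommGroup M] [Module A M] [AddCommGroup M'] [Module B M']

theorem IsCentralReduction.exists_endHom (hπ : IsCentralReduction π m) {q : M →ₛₗ[π] M'}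
    (hq : IsModReduction m q) :
    ∃ r : Module.End A M →+* Module.End B M', ∀ f x, r f (q x) = q (f x) := by
  choose r hr using fun f : Module.End A M => hπ.exists_reduce hq q f
  have hext : ∀ f' g' : Module.End B M', (∀ x, f' (q x) = g' (q x)) → f' = g' := fun f' g' h =>
    LinearMap.ext fun y => by
      obtain ⟨x, rfl⟩ := hq.surj y
      exact h x
  exact ⟨{ toFun := r
           map_one' := hext _ _ fun x => hr _ _
           map_mul' := fun f g => hext _ _ fun x => by
            rw [hr, Module.End.mul_apply, Module.End.mul_apply, hr, hr]
           map_zero' := hext _ _ fun x => by simp [hr]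
           map_add' := fun f g => hext _ _ fun x => by simp [hr] }, hr⟩

theorem isNilpotent_of_forall_mem_smul_top (hm : IsNilpotent m) {f : Module.End A M}
    (hf : ∀ x, f x ∈ m • (⊤ : Submodule (Subring.center A) M)) : IsNilpotent f := by
  have key : ∀ j x, (f ^ j) x ∈ m ^ j • (⊤ : Submodule (Subring.center A) M) := by
    intro j
    induction j with
    | zero => simp
    | succ j ih =>
      intro x
      have h1 : Submodule.map (f.restrictScalars (Subring.center A)) (m ^ j • ⊤) ≤
          m ^ (j + 1) • ⊤ := by
        rw [Submodule.map_smul'', pow_succ, Submodule.mul_smul]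
        refine Submodule.smul_mono le_rfl ?_
        rintro _ ⟨y, _, rfl⟩
        exact hf y
      rw [pow_succ' f, Module.End.mul_apply]
      exact h1 ⟨_, ih x, rfl⟩
  obtain ⟨n, hn⟩ := hm
  refine ⟨n, LinearMap.ext fun x => ?_⟩
  have := key n x
  rw [hn, zero_smul] at this
  exact (Submodule.mem_bot _).1 this

end Endomorphism

section

variable {A B : Type} [Ring A] [Ring B] {π : A →+* B} {m : Ideal (Subring.center A)}
  {M M' N N' : Type*} [AddCommGroup M] [Module A M] [AddCommGroup M'] [Module B M']
  [AddCommGroup N] [Module A N] [AddCommGroup N'] [Module B N']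

theorem IsModReduction.isIndecomposableModule_iff {q : M →ₛₗ[π] M'} (hq : IsModReduction m q)
    (hπ : IsCentralReduction π m) (hM : IsTauOrthogonal A M M) :
    IsIndecomposableModule B M' ↔ IsIndecomposableModule A M := by
  obtain ⟨r, hr⟩ := hπ.exists_endHom hq
  have hker : ∀ f, r f = 0 → IsNilpotent f := fun f hf =>
    isNilpotent_of_forall_mem_smul_top hπ.nil fun x => by
      rw [← hq.ker, ← hr, hf, LinearMap.zero_apply]
  rw [_root_.isIndecomposableModule_iff, _root_.isIndecomposableModule_iff, hq.nontrivial_iff hπ]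
  refine and_congr_right fun _ => ⟨fun h e he => ?_, fun h e he => ?_⟩
  · refine (h (r e) (he.map r)).imp (fun h0 => he.eq_zero_of_isNilpotent (hker _ h0)) fun h1 => ?_
    have := he.one_sub.eq_zero_of_isNilpotent
      (hker (1 - e) (by rw [map_sub, h1, map_one, sub_self]))
    exact (sub_eq_zero.1 this).symm
  · have hmem : e ∈ r.range := by
      obtain ⟨φ, hφ⟩ := hM.exists_lift hπ q hq e
      refine ⟨φ, LinearMap.ext fun y => ?_⟩
      obtain ⟨x, rfl⟩ := hq.surj y
      rw [hr, hφ]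
    obtain ⟨e, he', rfl⟩ := exists_isIdempotentElem_eq_of_ker_isNilpotent r
      (fun f hf => hker f hf) e hmem he
    exact (h e he').imp (fun h => by rw [h, map_zero]) fun h => by rw [h, map_one]

theorem IsModReduction.nonempty_linearEquiv {q : M →ₛₗ[π] M'} (hq : IsModReduction m q)
    {q₂ : N →ₛₗ[π] N'} (hq₂ : IsModReduction m q₂) (hπ : IsCentralReduction π m)
    (e : M ≃ₗ[A] N) : Nonempty (M' ≃ₗ[B] N') := by
  obtain ⟨f, hf⟩ := hπ.exists_reduce hq q₂ e.toLinearMap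
  obtain ⟨g, hg⟩ := hπ.exists_reduce hq₂ q e.symm.toLinearMap
  refine ⟨LinearEquiv.ofLinearMap f g (LinearMap.ext fun y => ?_) (LinearMap.ext fun y => ?_)⟩
  · obtain ⟨x, rfl⟩ := hq₂.surj y
    simp [hf, hg]
  · obtain ⟨x, rfl⟩ := hq.surj y
    simp [hf, hg]

theorem IsModReduction.nonempty_linearEquiv_iff [IsNoetherianRing A] [Module.Finite A M]
    {q : M →ₛₗ[π] M'} (hq : IsModReduction m q)
    {q₂ : N →ₛₗ[π] N'} (hq₂ : IsModReduction m q₂) (hπ : IsCentralReduction π m)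
    (hMN : IsTauOrthogonal A M N) (hNM : IsTauOrthogonal A N M) :
    Nonempty (M' ≃ₗ[B] N') ↔ Nonempty (M ≃ₗ[A] N) := by
  refine ⟨fun ⟨e⟩ => ?_, fun ⟨e⟩ => hq.nonempty_linearEquiv hq₂ hπ e⟩
  obtain ⟨f, hf⟩ := hMN.exists_lift hπ q hq₂ e.toLinearMap
  obtain ⟨g, hg⟩ := hNM.exists_lift hπ q₂ hq e.symm.toLinearMap
  exact ⟨LinearEquiv.ofBijective f (LinearMap.bijective_of_surjective_of_surjective
    (hq.surjective_of_surjective hq₂ hπ hf e.surjective)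
    (hq₂.surjective_of_surjective hq hπ hg e.symm.surjective))⟩

theorem IsTauOrthogonal.of_retract_of_surjective [IsArtinianRing A] [Module.Finite A M]
    (hM : IsTauOrthogonal A M M) {Y : Type*} [AddCommGroup Y] [Module A Y] {ι : Y →ₗ[A] M}
    {ρ : M →ₗ[A] Y} (hρι : ∀ y, ρ (ι y) = y) {ψ : M →ₗ[A] N} (hψ : Function.Surjective ψ) :
    IsTauOrthogonal A Y N :=
  (hM.of_sttGe (STTGe.of_surjective hψ)).of_retract hρι

theorem IsTauOrthogonal.pi_components [IsArtinianRing A] [Module.Finite A M]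
    (hM : IsTauOrthogonal A M M) {ι : Type*} {Y : ι → Type*} [∀ i, AddCommGroup (Y i)]
    [∀ i, Module A (Y i)] (e : M ≃ₗ[A] ∀ i, Y i) (i j : ι) : IsTauOrthogonal A (Y i) (Y j) := by
  classical
  refine hM.of_retract_of_surjective (ι := e.symm.toLinearMap.comp (LinearMap.single A Y i))
    (ρ := (LinearMap.proj i).comp e.toLinearMap) (fun y => by simp)
    (ψ := (LinearMap.proj j).comp e.toLinearMap) ?_
  exact (Function.surjective_eval j).comp e.surjective

theorem IsTauOrthogonal.pi_reduction_iff [IsArtinianRing A] [Module.Finite A M]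
    (hM : IsTauOrthogonal A M M) (hπ : IsCentralReduction π m) {t : ℕ}
    {Y : Fin t → Type*} [∀ i, AddCommGroup (Y i)] [∀ i, Module A (Y i)]
    {Y' : Fin t → Type*} [∀ i, AddCommGroup (Y' i)] [∀ i, Module B (Y' i)]
    {r : ∀ i, Y i →ₛₗ[π] Y' i} (hr : ∀ i, IsModReduction m (r i)) (e : M ≃ₗ[A] ∀ i, Y i) :
    (∀ i, IsIndecomposableModule B (Y' i) ↔ IsIndecomposableModule A (Y i)) ∧
    ∀ i j, Nonempty (Y' i ≃ₗ[B] Y' j) ↔ Nonempty (Y i ≃ₗ[A] Y j) := by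
  have hY := hM.pi_components e
  have hf : ∀ i, Module.Finite A (Y i) := fun i =>
    Module.Finite.of_surjective ((LinearMap.proj i).comp e.toLinearMap)
      ((Function.surjective_eval i).comp e.surjective)
  exact ⟨fun i => (hr i).isIndecomposableModule_iff hπ (hY i i),
    fun i j => (hr i).nonempty_linearEquiv_iff (hr j) hπ (hY i j) (hY j i)⟩

theorem IsModReduction.hasDecomposition_iff [IsArtinianRing A] [Module.Finite A M]
    {q : M →ₛₗ[π] M'} (hq : IsModReduction m q) (hπ : IsCentralReduction π m)
    (hM : IsTauOrthogonal A M M) {t : ℕ} {p : Fin t → Fin t → Prop} :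
    HasDecomposition A M t p ↔ HasDecomposition B M' t p := by
  classical
  constructor
  · intro h
    obtain ⟨X, hX, hp, ⟨e⟩⟩ := h.exists_equiv_pi
    choose Y' i₁ i₂ r hr using fun i => hπ.exists_isModReduction (X i)
    obtain ⟨e'⟩ := hq.nonempty_linearEquiv (IsModReduction.pi hr) hπ e
    obtain ⟨h1, h2⟩ := hM.pi_reduction_iff hπ hr e
    exact HasDecomposition.of_equiv_pi e' (fun i => (h1 i).2 (hX i))
      fun i j => (h2 i j).trans (hp i j)
  · intro h
    obtain ⟨X, hX, hp, ⟨e⟩⟩ := h.exists_equiv_pi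
    have : IsArtinianRing B := hπ.surj.isArtinianRing
    have : Module.Finite B M' := hq.finite hπ
    have hM' : IsTauOrthogonal B M' M' := hM.reduce hπ hq hq
    let s (i : Fin t) : X i →ₗ[B] M' :=
      e.symm.toLinearMap.comp (LinearMap.single B (fun i => X i) i)
    have hX' (i : Fin t) : IsTauOrthogonal B (X i) M' :=
      hM'.of_retract (ι := s i) (ρ := (LinearMap.proj i).comp e.toLinearMap)
        (fun y => by simp [s])
    choose Y i₁ i₂ r hf hr hY using fun i => (hX' i).exists_module_lift hπ
    choose φ hφ using fun i => (hY i M q hq).exists_lift hπ (r i) hq (s i)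
    let Φ : (∀ i, Y i) →ₗ[A] M := ∑ i, (φ i).comp (LinearMap.proj i)
    have hΦ : Function.Surjective Φ := by
      refine (IsModReduction.pi hr).surjective_of_surjective hq hπ (φ' := e.symm.toLinearMap)
        (fun x => ?_) e.symm.surjective
      simp only [Φ, LinearMap.sum_apply, LinearMap.comp_apply, map_sum, LinearMap.proj_apply, hφ]
      simp only [s, LinearMap.comp_apply, ← map_sum]
      congr 1
      exact Finset.univ_sum_single _
    obtain ⟨Ψ, hΨ⟩ := (hM.of_sttGe_reduce hπ hq (IsModReduction.pi hr)
      (STTGe.of_surjective (p := e.toLinearMap) e.surjective)).exists_lift hπ q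
      (IsModReduction.pi hr) e.toLinearMap
    have hΨ' := hq.surjective_of_surjective (IsModReduction.pi hr) hπ hΨ e.surjective
    let e' : M ≃ₗ[A] ∀ i, Y i := LinearEquiv.ofBijective Ψ
      (LinearMap.bijective_of_surjective_of_surjective hΨ' hΦ)
    obtain ⟨h1, h2⟩ := hM.pi_reduction_iff hπ hr e'
    exact HasDecomposition.of_equiv_pi e' (fun i => (h1 i).1 (hX i))
      fun i j => (h2 i j).symm.trans (hp i j)

end

end Decomposition

section SupportTauTilting

universe u v

theorem HasDecomposition.congr {A M N : Type*} [Ring A] [AddCommGroup M] [Module A M]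
    [AddCommGroup N] [Module A N] (e : M ≃ₗ[A] N) {t : ℕ} {p : Fin t → Fin t → Prop}
    (h : HasDecomposition A M t p) : HasDecomposition A N t p := by
  obtain ⟨X, hX, hp, ⟨f⟩⟩ := h.exists_equiv_pi
  exact HasDecomposition.of_equiv_pi (e.symm.trans f) hX hp

theorem HasIndecCount.congr {A M N : Type*} [Ring A] [AddCommGroup M] [Module A M]
    [AddCommGroup N] [Module A N] (e : M ≃ₗ[A] N) {n : ℕ}
    (h : HasIndecCount A M n) : HasIndecCount A N n := by
  obtain ⟨t, p, h, hn⟩ := hasIndecCount_iff.1 h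
  exact hasIndecCount_iff.2 ⟨t, p, h.congr e, hn⟩

theorem isSupportTauTilting_iff {A : Type} {M : Type*} [Ring A] [AddCommGroup M] [Module A M] :
    IsSupportTauTilting A M ↔ IsTauRigid A M ∧
      ∃ (P : Type) (_ : AddCommGroup P) (_ : Module A P), Module.Finite A P ∧
        Module.Projective A P ∧ (∀ f : P →ₗ[A] M, f = 0) ∧
        ∃ nP nM nA : ℕ, HasIndecCount A P nP ∧ HasIndecCount A M nM ∧
          HasIndecCount A A nA ∧ nP + nM = nA := by
  refine and_congr_right fun _ => ⟨?_, ?_⟩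
  · rintro ⟨n, P, Q, hPQ, h⟩
    have hr : (Submodule.projectionOnto P Q hPQ).comp P.subtype = LinearMap.id :=
      LinearMap.ext fun x => by simp
    exact ⟨P, _, _, Module.Finite.of_surjective (Submodule.projectionOnto P Q hPQ)
      (fun x => ⟨x, LinearMap.congr_fun hr x⟩), Module.Projective.of_split _ _ hr, h⟩
  · rintro ⟨P, _, _, _, _, h, nP, nM, nA, hP, h'⟩
    obtain ⟨n, f, hf⟩ := Module.Finite.exists_fin' A P
    obtain ⟨s, hs⟩ := Module.projective_lifting_property f LinearMap.id hf
    have hs' : ∀ x, f (s x) = x := fun x => LinearMap.congr_fun hs x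
    let c : P ≃ₗ[A] LinearMap.range s :=
      LinearEquiv.ofInjective s (Function.LeftInverse.injective hs')
    have hcompl : IsCompl (LinearMap.range s) (LinearMap.ker f) := by
      refine IsCompl.of_eq ((Submodule.eq_bot_iff _).2 ?_) (eq_top_iff.2 fun x _ => ?_)
      · rintro _ ⟨⟨y, rfl⟩, hy⟩
        have h0 : f (s y) = 0 := hy
        rw [hs'] at h0
        rw [h0, map_zero]
      · rw [← add_sub_cancel (s (f x)) x]
        exact Submodule.add_mem_sup ⟨_, rfl⟩ (by rw [LinearMap.mem_ker, map_sub, hs', sub_self])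
    refine ⟨n, _, _, hcompl, fun φ => ?_, nP, nM, nA, hP.congr c, h'⟩
    refine LinearMap.ext fun x => ?_
    have := LinearMap.congr_fun (h (φ.comp c.toLinearMap)) (c.symm x)
    simpa using this

theorem Module.Finite.exists_linearEquiv (A : Type) [Ring A] (M : Type u) [AddCommGroup M]
    [Module A M] [Module.Finite A M] :
    ∃ (N : Type v) (_ : AddCommGroup N) (_ : Module A N), Nonempty (N ≃ₗ[A] M) := by
  obtain ⟨n, f, hf⟩ := Module.Finite.exists_fin' A M
  exact ⟨ULift.{v} ((Fin n → A) ⧸ LinearMap.ker f), _, _,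
    ⟨ULift.moduleEquiv.trans (f.quotKerEquivOfSurjective hf)⟩⟩

variable {A B : Type} [Ring A] [Ring B] {π : A →+* B} {m : Ideal (Subring.center A)}
  {M M' N N' : Type*} [AddCommGroup M] [Module A M] [AddCommGroup M'] [Module B M']
  [AddCommGroup N] [Module A N] [AddCommGroup N'] [Module B N']

namespace IsModReduction

theorem hasIndecCount_iff [IsArtinianRing A] [Module.Finite A M]
    {q : M →ₛₗ[π] M'} (hq : IsModReduction m q) (hπ : IsCentralReduction π m)
    (hM : IsTauOrthogonal A M M) {n : ℕ} : HasIndecCount A M n ↔ HasIndecCount B M' n := by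
  simp only [_root_.hasIndecCount_iff, hq.hasDecomposition_iff hπ hM]

theorem isBasicModule_iff [IsArtinianRing A] [Module.Finite A M]
    {q : M →ₛₗ[π] M'} (hq : IsModReduction m q) (hπ : IsCentralReduction π m)
    (hM : IsTauOrthogonal A M M) : IsBasicModule A M ↔ IsBasicModule B M' := by
  simp only [_root_.isBasicModule_iff, hq.hasDecomposition_iff hπ hM]

theorem isSupportTauTilting_iff [IsArtinianRing A] [Module.Finite A M]
    {q : M →ₛₗ[π] M'} (hq : IsModReduction m q) (hπ : IsCentralReduction π m)
    (hM : IsTauOrthogonal A M M) : IsSupportTauTilting A M ↔ IsSupportTauTilting B M' := by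
  rw [_root_.isSupportTauTilting_iff, _root_.isSupportTauTilting_iff]
  have hM' : IsTauOrthogonal B M' M' := hM.reduce hπ hq hq
  refine and_congr (iff_of_true hM.isTauRigid hM'.isTauRigid) ⟨?_, ?_⟩
  · rintro ⟨P, _, _, _, _, h, nP, nM, nA, hP, hnM, hA, hn⟩
    obtain ⟨P', _, _, r, hr⟩ := hπ.exists_isModReduction P
    exact ⟨P', _, _, hr.finite hπ, hr.projective hπ, (hr.hom_eq_zero_iff hq hπ).2 h, nP, nM, nA,
      (hr.hasIndecCount_iff hπ .of_projective).1 hP, (hq.hasIndecCount_iff hπ hM).1 hnM,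
      (hπ.isModReduction_toSemilinear.hasIndecCount_iff hπ .of_projective).1 hA, hn⟩
  · rintro ⟨P', _, _, _, _, h, nP, nM, nA, hP, hnM, hA, hn⟩
    obtain ⟨P, _, _, r, _, _, hr⟩ := exists_projective_lift (M' := P') hπ
    exact ⟨P, _, _, inferInstance, inferInstance, (hr.hom_eq_zero_iff hq hπ).1 h, nP, nM, nA,
      (hr.hasIndecCount_iff hπ .of_projective).2 hP, (hq.hasIndecCount_iff hπ hM).2 hnM,
      (hπ.isModReduction_toSemilinear.hasIndecCount_iff hπ .of_projective).2 hA, hn⟩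

theorem sttGe_iff {q : M →ₛₗ[π] M'} (hq : IsModReduction m q) {q₂ : N →ₛₗ[π] N'}
    (hq₂ : IsModReduction m q₂) (hπ : IsCentralReduction π m) (hM : IsTauOrthogonal A M M) :
    STTGe A M N ↔ STTGe B M' N' := by
  constructor
  · rintro ⟨t, p, hp⟩
    obtain ⟨p', hp'⟩ := hπ.exists_reduce (IsModReduction.pi fun _ : Fin t => hq) q₂ p
    refine ⟨t, p', fun y => ?_⟩
    obtain ⟨x, rfl⟩ := hq₂.surj y
    obtain ⟨z, rfl⟩ := hp x
    exact ⟨_, hp' z⟩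
  · intro h
    have hMN : IsTauOrthogonal A M N := hM.of_sttGe_reduce hπ hq hq₂ h
    obtain ⟨t, p', hp'⟩ := h
    choose φ hφ using fun i : Fin t =>
      hMN.exists_lift hπ q hq₂ (p'.comp (LinearMap.single B (fun _ => M') i))
    refine ⟨t, ∑ i, (φ i).comp (LinearMap.proj i), ?_⟩
    refine (IsModReduction.pi fun _ : Fin t => hq).surjective_of_surjective hq₂ hπ (φ' := p')
      (fun x => ?_) hp'
    simp only [LinearMap.sum_apply, LinearMap.comp_apply, map_sum, LinearMap.proj_apply, hφ]
    rw [← map_sum]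
    congr 1
    exact Finset.univ_sum_single _

theorem nonempty_linearEquiv_iff_of_isTauOrthogonal [IsNoetherianRing A] [Module.Finite A M]
    {q : M →ₛₗ[π] M'} (hq : IsModReduction m q) {q₂ : N →ₛₗ[π] N'} (hq₂ : IsModReduction m q₂)
    (hπ : IsCentralReduction π m) (hM : IsTauOrthogonal A M M) (hN : IsTauOrthogonal A N N) :
    Nonempty (M ≃ₗ[A] N) ↔ Nonempty (M' ≃ₗ[B] N') := by
  refine ⟨fun ⟨e⟩ => hq.nonempty_linearEquiv hq₂ hπ e, fun ⟨e⟩ => ?_⟩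
  exact (hq.nonempty_linearEquiv_iff hq₂ hπ
    (hM.of_sttGe_reduce hπ hq hq₂ (STTGe.of_surjective (p := e.toLinearMap) e.surjective))
    (hN.of_sttGe_reduce hπ hq₂ hq
      (STTGe.of_surjective (p := e.symm.toLinearMap) e.symm.surjective))).1 ⟨e⟩

end IsModReduction

end SupportTauTilting

section GroupAlgebra

open MonoidAlgebra

section

variable {k : Type*} [Field k] {G : Type*} [Group G]

theorem single_one_mem_center {n : G} (hn : n ∈ Subgroup.center G) :
    (single n 1 : MonoidAlgebra k G) ∈ Subring.center (MonoidAlgebra k G) :=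
  Subring.mem_center_iff.2 fun a =>
    (single_commute (fun g => (Subgroup.mem_center_iff.1 hn g).symm) (fun r => Commute.one_left r)
      a).symm

theorem isNilpotent_single_sub_one {p : ℕ} [Fact p.Prime] [CharP k p] {n : G} {a : ℕ}
    (hn : n ^ p ^ a = 1) : IsNilpotent (single n 1 - 1 : MonoidAlgebra k G) := by
  have : CharP (MonoidAlgebra k G) p :=
    charP_of_injective_algebraMap (algebraMap k (MonoidAlgebra k G)).injective p
  refine ⟨p ^ a, ?_⟩
  rw [sub_pow_char_pow_of_commute p a (Commute.one_right _), single_pow, hn, one_pow, one_pow,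
    one_def, sub_self]

/-- A central element `n - 1` with `n` of `p`-power order lies in the Jacobson radical. -/
theorem single_sub_one_mem_jacobson {p : ℕ} [Fact p.Prime] [CharP k p] {n : G} {a : ℕ}
    (hn : n ^ p ^ a = 1) (hc : n ∈ Subgroup.center G) :
    (single n 1 - 1 : MonoidAlgebra k G) ∈ (⊥ : Ideal (MonoidAlgebra k G)).jacobson := by
  refine Ideal.mem_jacobson_iff.2 fun y => ?_
  have hcomm : Commute y (single n 1 - 1) :=
    Subring.mem_center_iff.1 (sub_mem (single_one_mem_center hc) (one_mem _)) y
  obtain ⟨u, hu⟩ := (hcomm.isNilpotent_mul_left (isNilpotent_single_sub_one hn)).isUnit_add_one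
  refine ⟨↑u⁻¹, ?_⟩
  have : (↑u⁻¹ : MonoidAlgebra k G) * u = 1 := u.inv_mul
  rw [hu, mul_add, mul_one, ← mul_assoc] at this
  rw [this, sub_self]
  exact Ideal.zero_mem _

/-- The Jacobson radical of a group algebra is contained in the augmentation ideal. -/
theorem lift_one_eq_zero_of_mem_jacobson {x : MonoidAlgebra k G}
    (hx : x ∈ (⊥ : Ideal (MonoidAlgebra k G)).jacobson) :
    MonoidAlgebra.lift k k G 1 x = 0 := by
  by_contra h
  obtain ⟨z, hz⟩ := Ideal.mem_jacobson_iff.1 hx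
    (algebraMap k _ (-(MonoidAlgebra.lift k k G 1 x)⁻¹))
  have := congrArg (MonoidAlgebra.lift k k G 1) ((Submodule.mem_bot _).1 hz)
  rw [map_sub, map_add, map_mul, map_mul, AlgHom.commutes,
    map_one (MonoidAlgebra.lift k k G 1), map_zero, mul_assoc,
    Algebra.algebraMap_self, RingHom.id_apply, neg_mul, inv_mul_cancel₀ h, mul_neg, mul_one,
    neg_add_cancel, zero_sub] at this
  exact one_ne_zero (neg_eq_zero.1 this)

end

variable (k : Type*) [Field k] (G : Type*) [Group G] (N : Subgroup G)

/-- The ideal of the center of `kG` generated by the elements `n - 1` with `n` in the central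
subgroup `N`. -/
noncomputable def centerAugmentation (hNZ : N ≤ Subgroup.center G) :
    Ideal (Subring.center (MonoidAlgebra k G)) :=
  Ideal.span (Set.range fun n : N => (⟨single (n : G) 1 - 1,
    sub_mem (single_one_mem_center (hNZ n.2)) (one_mem _)⟩ : Subring.center (MonoidAlgebra k G)))

variable {k G N} {p : ℕ} [Fact p.Prime] [CharP k p]

theorem centerAugmentation_fg [Finite N] (hNZ : N ≤ Subgroup.center G) :
    (centerAugmentation k G N hNZ).FG :=
  Submodule.fg_span (Set.finite_range _)

theorem isNilpotent_centerAugmentation [Finite N] (hNZ : N ≤ Subgroup.center G)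
    (hN : IsPGroup p N) : IsNilpotent (centerAugmentation k G N hNZ) := by
  rw [(centerAugmentation_fg hNZ).isNilpotent_iff_le_nilradical, centerAugmentation, Ideal.span_le]
  rintro _ ⟨n, rfl⟩
  obtain ⟨a, ha⟩ := hN n
  obtain ⟨j, hj⟩ := isNilpotent_single_sub_one (k := k) (n := (n : G)) (p := p) (a := a)
    (by exact_mod_cast congrArg Subtype.val ha)
  exact mem_nilradical.2 ⟨j, Subtype.ext hj⟩

theorem mem_radIdeal_of_mem_centerAugmentation (hNZ : N ≤ Subgroup.center G) (hN : IsPGroup p N)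
    {c : Subring.center (MonoidAlgebra k G)} (hc : c ∈ centerAugmentation k G N hNZ) :
    (c : MonoidAlgebra k G) ∈ radIdeal k G N := by
  suffices centerAugmentation k G N hNZ ≤ (radIdeal k G N).comap
      (Subring.center (MonoidAlgebra k G)).subtype from this hc
  rw [centerAugmentation, Ideal.span_le]
  rintro _ ⟨n, rfl⟩
  obtain ⟨a, ha⟩ := hN n
  have hn : n ∈ Subgroup.center N := Subgroup.mem_center_iff.2 fun g =>
    Subtype.ext (Subgroup.mem_center_iff.1 (hNZ n.2) g)
  refine Ideal.subset_span ⟨_, single_sub_one_mem_jacobson ha hn, ?_⟩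
  rw [map_sub, map_one, mapDomainRingHom_apply, mapDomain_single]
  rfl

variable [N.Normal]

theorem quotMap_single (g : G) (r : k) :
    quotMap k G N (single g r) = single (g : G ⧸ N) r := by
  rw [quotMap, mapDomainRingHom_apply, mapDomain_single]
  rfl

theorem quotMap_surjective : Function.Surjective (quotMap k G N) := by
  intro y
  induction y using MonoidAlgebra.induction_linear with
  | zero => exact ⟨0, map_zero _⟩
  | add x y hx hy =>
    obtain ⟨a, rfl⟩ := hx
    obtain ⟨b, rfl⟩ := hy
    exact ⟨a + b, map_add _ _ _⟩
  | single g r =>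
    obtain ⟨g, rfl⟩ := QuotientGroup.mk_surjective g
    exact ⟨single g r, quotMap_single g r⟩

theorem quotMap_eq_zero_of_mem_centerAugmentation (hNZ : N ≤ Subgroup.center G)
    {c : Subring.center (MonoidAlgebra k G)} (hc : c ∈ centerAugmentation k G N hNZ) :
    quotMap k G N c = 0 := by
  suffices centerAugmentation k G N hNZ ≤
      RingHom.ker ((quotMap k G N).comp (Subring.center (MonoidAlgebra k G)).subtype) from this hc
  rw [centerAugmentation, Ideal.span_le]
  rintro _ ⟨n, rfl⟩
  change quotMap k G N (single (n : G) 1 - 1) = 0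
  rw [map_sub, map_one, quotMap_single, (QuotientGroup.eq_one_iff (n : G)).2 n.2, one_def, sub_self]

theorem quotMap_eq_zero_iff (hNZ : N ≤ Subgroup.center G) (a : MonoidAlgebra k G) :
    quotMap k G N a = 0 ↔ a ∈ centerAugmentation k G N hNZ •
      (⊤ : Submodule (Subring.center (MonoidAlgebra k G)) (MonoidAlgebra k G)) := by
  constructor
  · intro ha
    have key : a - mapDomain Quotient.out (quotMap k G N a) ∈ centerAugmentation k G N hNZ •
        (⊤ : Submodule (Subring.center (MonoidAlgebra k G)) (MonoidAlgebra k G)) := by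
      clear ha
      induction a using MonoidAlgebra.induction_linear with
      | zero => simp
      | add x y hx hy =>
        rw [map_add, mapDomain_add, add_sub_add_comm]
        exact add_mem hx hy
      | single g r =>
        rw [quotMap_single, mapDomain_single]
        obtain ⟨n, hn⟩ : ∃ n : N, g = n * (Quotient.out (g : G ⧸ N)) := by
          obtain ⟨n, hn⟩ := QuotientGroup.mk_out_eq_mul N g
          refine ⟨n⁻¹, ?_⟩
          rw [hn, Subgroup.mem_center_iff.1 (hNZ n.2) g]
          simp
        have : (single g r - single (Quotient.out (g : G ⧸ N)) r : MonoidAlgebra k G) =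
            (⟨single (n : G) 1 - 1, sub_mem (single_one_mem_center (hNZ n.2)) (one_mem _)⟩ :
              Subring.center (MonoidAlgebra k G)) • single (Quotient.out (g : G ⧸ N)) r := by
          change _ = (single (n : G) 1 - 1) * single (Quotient.out (g : G ⧸ N)) r
          rw [sub_mul, one_mul, single_mul_single, ← hn, one_mul]
        rw [this]
        exact Submodule.smul_mem_smul (Ideal.subset_span ⟨n, rfl⟩) trivial
    rwa [ha, mapDomain_zero, sub_zero] at key
  · intro ha
    refine Submodule.smul_induction_on ha (fun c hc x _ => ?_)
      fun x y hx hy => by rw [map_add, hx, hy, add_zero]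
    change quotMap k G N (c * x) = 0
    rw [map_mul, quotMap_eq_zero_of_mem_centerAugmentation hNZ hc, zero_mul]

theorem isCentralReduction_quotMap [Finite N] (hNZ : N ≤ Subgroup.center G) (hN : IsPGroup p N) :
    IsCentralReduction (quotMap k G N) (centerAugmentation k G N hNZ) :=
  ⟨quotMap_surjective, centerAugmentation_fg hNZ, isNilpotent_centerAugmentation hNZ hN,
    quotMap_eq_zero_iff hNZ⟩

theorem quotMap_eq_zero_of_mem_radIdeal {a : MonoidAlgebra k G} (ha : a ∈ radIdeal k G N) :
    quotMap k G N a = 0 := by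
  suffices radIdeal k G N ≤ RingHom.ker (quotMap k G N) from this ha
  rw [radIdeal, Ideal.span_le]
  rintro _ ⟨x, hx, rfl⟩
  have h : (quotMap k G N).comp (mapDomainRingHom k N.subtype) =
      (algebraMap k (MonoidAlgebra k (G ⧸ N))).comp
        (MonoidAlgebra.lift k k N 1 : MonoidAlgebra k N →ₐ[k] k).toRingHom := by
    refine MonoidAlgebra.ringHom_ext (fun r => ?_) fun n => ?_
    · simp [quotMap_single]
    · have : ((n : G) : G ⧸ N) = 1 := (QuotientGroup.eq_one_iff (n : G)).2 n.2
      simp [quotMap_single, this]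
  have := RingHom.congr_fun h x
  change quotMap k G N (mapDomainRingHom k N.subtype x) =
    algebraMap k _ (MonoidAlgebra.lift k k N 1 x) at this
  rwa [lift_one_eq_zero_of_mem_jacobson hx, map_zero] at this

theorem mem_radIdeal_smul_top_iff (hNZ : N ≤ Subgroup.center G) (hN : IsPGroup p N) {M : Type*}
    [AddCommGroup M] [Module (MonoidAlgebra k G) M] {x : M} :
    x ∈ radIdeal k G N • (⊤ : Submodule (MonoidAlgebra k G) M) ↔
      x ∈ centerAugmentation k G N hNZ •
        (⊤ : Submodule (Subring.center (MonoidAlgebra k G)) M) := by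
  constructor <;> intro hx
  · refine Submodule.smul_induction_on hx (fun a ha y _ => ?_) fun x y hx hy => add_mem hx hy
    exact (LinearMap.toSpanSingleton (MonoidAlgebra k G) M y).map_mem_center_smul_top
      ((quotMap_eq_zero_iff hNZ a).1 (quotMap_eq_zero_of_mem_radIdeal ha))
  · refine Submodule.smul_induction_on hx (fun c hc y _ => ?_) fun x y hx hy => add_mem hx hy
    exact Submodule.smul_mem_smul (mem_radIdeal_of_mem_centerAugmentation hNZ hN hc) trivial

theorem sttRel_iff (hNZ : N ≤ Subgroup.center G) (hN : IsPGroup p N)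
    (M : ModuleCat (MonoidAlgebra k G)) (M' : ModuleCat (MonoidAlgebra k (G ⧸ N))) :
    sttRel k G N M M' ↔
      ∃ q : M →ₛₗ[quotMap k G N] M', IsModReduction (centerAugmentation k G N hNZ) q := by
  constructor
  · rintro ⟨e⟩
    let q : M →ₛₗ[quotMap k G N] M' :=
      { toFun := fun x => e.symm (Submodule.Quotient.mk x)
        map_add' := fun x y => by rw [Submodule.Quotient.mk_add, map_add]; rfl
        map_smul' := fun a x => by
          rw [Submodule.Quotient.mk_smul, map_smul, ModuleCat.restrictScalars.smul_def] }
    refine ⟨q, e.symm.surjective.comp (Submodule.Quotient.mk_surjective _), fun x => ?_⟩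
    rw [← mem_radIdeal_smul_top_iff hNZ hN, ← Submodule.Quotient.mk_eq_zero]
    exact e.symm.map_eq_zero_iff
  · rintro ⟨q, hq⟩
    let f : M →ₗ[MonoidAlgebra k G] (ModuleCat.restrictScalars (quotMap k G N)).obj M' :=
      { toFun := q
        map_add' := map_add q
        map_smul' := fun a x => map_smulₛₗ q a x }
    have hf : radIdeal k G N • (⊤ : Submodule (MonoidAlgebra k G) M) = LinearMap.ker f := by
      ext x
      rw [mem_radIdeal_smul_top_iff hNZ hN, ← hq.ker]
      rfl
    exact ⟨(f.quotKerEquivOfSurjective hq.surj).symm.trans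
      (Submodule.quotEquivOfEq _ _ hf).symm⟩

end GroupAlgebra

/-- Let `k` be an algebraically closed field of characteristic
`p > 0`, `G` a finite group and `N` a `p`-subgroup of the center `Z(G)`.  Then
`M ↦ M/J(kN)M` induces an order-preserving bijection between the isomorphism classes of
basic support τ-tilting `kG`-modules and the isomorphism classes of basic support
τ-tilting `k(G/N)`-modules. -/
theorem stmt_15 (k : Type) [Field k] [IsAlgClosed k] (p : ℕ) [Fact p.Prime] [CharP k p]
    (G : Type) [Group G] [Fintype G]
    (N : Subgroup G) [N.Normal] (hNZ : N ≤ Subgroup.center G) (hN : IsPGroup p N) :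
    -- the map `M ↦ M/J(kN)M` sends basic support τ-tilting `kG`-modules to basic
    -- support τ-tilting `k(G/N)`-modules:
    (∀ M : ModuleCat (MonoidAlgebra k G),
      Module.Finite (MonoidAlgebra k G) M → IsBasicModule (MonoidAlgebra k G) M →
      IsSupportTauTilting (MonoidAlgebra k G) M →
      ∃ M' : ModuleCat (MonoidAlgebra k (G ⧸ N)),
        Module.Finite (MonoidAlgebra k (G ⧸ N)) M' ∧
        IsBasicModule (MonoidAlgebra k (G ⧸ N)) M' ∧
        IsSupportTauTilting (MonoidAlgebra k (G ⧸ N)) M' ∧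
        sttRel k G N M M') ∧
    -- it is surjective on isomorphism classes:
    (∀ M' : ModuleCat (MonoidAlgebra k (G ⧸ N)),
      Module.Finite (MonoidAlgebra k (G ⧸ N)) M' →
      IsBasicModule (MonoidAlgebra k (G ⧸ N)) M' →
      IsSupportTauTilting (MonoidAlgebra k (G ⧸ N)) M' →
      ∃ M : ModuleCat (MonoidAlgebra k G),
        Module.Finite (MonoidAlgebra k G) M ∧
        IsBasicModule (MonoidAlgebra k G) M ∧
        IsSupportTauTilting (MonoidAlgebra k G) M ∧
        sttRel k G N M M') ∧
    -- it reflects and preserves isomorphism (hence is a bijection on isomorphism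
    -- classes) and it preserves and reflects the partial order:
    (∀ (M N₁ : ModuleCat (MonoidAlgebra k G))
        (M' N₁' : ModuleCat (MonoidAlgebra k (G ⧸ N))),
      Module.Finite (MonoidAlgebra k G) M → IsBasicModule (MonoidAlgebra k G) M →
      IsSupportTauTilting (MonoidAlgebra k G) M →
      Module.Finite (MonoidAlgebra k G) N₁ → IsBasicModule (MonoidAlgebra k G) N₁ →
      IsSupportTauTilting (MonoidAlgebra k G) N₁ →
      Module.Finite (MonoidAlgebra k (G ⧸ N)) M' →
      IsBasicModule (MonoidAlgebra k (G ⧸ N)) M' →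
      IsSupportTauTilting (MonoidAlgebra k (G ⧸ N)) M' →
      Module.Finite (MonoidAlgebra k (G ⧸ N)) N₁' →
      IsBasicModule (MonoidAlgebra k (G ⧸ N)) N₁' →
      IsSupportTauTilting (MonoidAlgebra k (G ⧸ N)) N₁' →
      sttRel k G N M M' → sttRel k G N N₁ N₁' →
      (Nonempty ((M : Type) ≃ₗ[MonoidAlgebra k G] (N₁ : Type)) ↔
        Nonempty ((M' : Type) ≃ₗ[MonoidAlgebra k (G ⧸ N)] (N₁' : Type))) ∧
      (STTGe (MonoidAlgebra k G) M N₁ ↔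
        STTGe (MonoidAlgebra k (G ⧸ N)) M' N₁')) := by
  have hπ := isCentralReduction_quotMap (k := k) hNZ hN
  have hArt : IsArtinianRing (MonoidAlgebra k G) := IsArtinianRing.of_finite k _
  have hArt' : IsArtinianRing (MonoidAlgebra k (G ⧸ N)) := hπ.surj.isArtinianRing
  refine ⟨fun M _ hb hs => ?_, fun M' _ hb hs => ?_, ?_⟩
  · have hM := hs.1.isTauOrthogonal
    obtain ⟨M₀, _, _, q₀, hq₀⟩ := hπ.exists_isModReduction M
    have := hq₀.finite hπ
    obtain ⟨M', _, _, ⟨e⟩⟩ := Module.Finite.exists_linearEquiv (MonoidAlgebra k (G ⧸ N)) M₀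
    have hq := hq₀.equiv_comp e.symm
    exact ⟨ModuleCat.of _ M', hq.finite hπ, (hq.isBasicModule_iff hπ hM).1 hb,
      (hq.isSupportTauTilting_iff hπ hM).1 hs, (sttRel_iff hNZ hN M (ModuleCat.of _ M')).2 ⟨_, hq⟩⟩
  · obtain ⟨X, _, _, q₀, _, hq₀, hX⟩ := hs.1.isTauOrthogonal.exists_module_lift hπ
    obtain ⟨M, _, _, ⟨e⟩⟩ := Module.Finite.exists_linearEquiv (MonoidAlgebra k G) X
    have hq := hq₀.comp_equiv e
    have : Module.Finite (MonoidAlgebra k G) M := Module.Finite.equiv e.symm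
    have hM : IsTauOrthogonal (MonoidAlgebra k G) M M :=
      (hX M _ hq).of_retract (ι := e.toLinearMap) (ρ := e.symm.toLinearMap) e.symm_apply_apply
    exact ⟨ModuleCat.of _ M, this, (hq.isBasicModule_iff hπ hM).2 hb,
      (hq.isSupportTauTilting_iff hπ hM).2 hs, (sttRel_iff hNZ hN (ModuleCat.of _ M) M').2 ⟨_, hq⟩⟩
  · intro M N₁ M' N₁' _ _ hs _ _ hs₁ _ _ _ _ _ _ h h₁
    obtain ⟨q, hq⟩ := (sttRel_iff hNZ hN M M').1 h
    obtain ⟨q₁, hq₁⟩ := (sttRel_iff hNZ hN N₁ N₁').1 h₁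
    have hM := hs.1.isTauOrthogonal
    exact ⟨hq.nonempty_linearEquiv_iff_of_isTauOrthogonal hq₁ hπ hM hs₁.1.isTauOrthogonal,
      hq.sttGe_iff hq₁ hπ hM⟩
end

section
/- Let k be a field of characteristic 2 and D_{2n} the dihedral group of order 2n with n odd. Then the group algebra kD_{2n} is isomorphic to a direct product k[x]/(x²) × M₂(k)^{(n−1)/2}; in particular every support τ-tilting kD_{2n}-module is projective and every semibrick over kD_{2n} is semisimple. -/
/-- The two-dimensional dihedral representation attached to an additive character of `ZMod n`. -/
def DihedralGroup.matrixRep {R : Type*} [CommRing R] {n : ℕ} (ψ : AddChar (ZMod n) R) :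
    DihedralGroup n →* Matrix (Fin 2) (Fin 2) R where
  toFun
    | .r i => !![ψ i, 0; 0, ψ (-i)]
    | .sr i => !![0, ψ (-i); ψ i, 0]
  map_one' := by
    rw [DihedralGroup.one_def]
    simp [Matrix.one_fin_two]
  map_mul' := by
    rintro (i | i) (j | j) <;>
      simp [← AddChar.map_add_eq_mul, sub_eq_add_neg, add_comm]

/-- The homomorphism from the dihedral group killing the rotations and sending every reflection
to a fixed involution. -/
def DihedralGroup.involutionHom {A : Type*} [Monoid A] (n : ℕ) (u : A) (hu : u * u = 1) :
    DihedralGroup n →* A where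
  toFun
    | .r _ => 1
    | .sr _ => u
  map_one' := by rw [DihedralGroup.one_def]
  map_mul' := by rintro (i | i) (j | j) <;> simp [hu]

/-- A function on `ZMod n` is determined by its discrete Fourier transform. -/
theorem AddChar.eq_zero_of_forall_sum_mul_eq_zero {k : Type*} [Field k] {n : ℕ} [NeZero n]
    (hn : (n : k) ≠ 0) {ψ : AddChar (ZMod n) k} (hψ : ψ.IsPrimitive) {f : ZMod n → k}
    (hf : ∀ j, ∑ i, f i * ψ (j * i) = 0) : f = 0 := by
  funext l
  have key : ∑ j, ψ (-(j * l)) * ∑ i, f i * ψ (j * i) = n * f l := by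
    calc ∑ j, ψ (-(j * l)) * ∑ i, f i * ψ (j * i)
        = ∑ i, f i * ∑ j, ψ (j * (i - l)) := by
          simp_rw [Finset.mul_sum]
          rw [Finset.sum_comm]
          refine Finset.sum_congr rfl fun i _ => Finset.sum_congr rfl fun j _ => ?_
          rw [mul_sub, sub_eq_add_neg, AddChar.map_add_eq_mul]
          ring
      _ = n * f l := by
          simp_rw [AddChar.sum_mulShift _ hψ, sub_eq_zero]
          simp [mul_comm]
  simp only [hf, mul_zero, Finset.sum_const_zero] at key
  simpa [hn] using key.symm

theorem DihedralGroup.sum_eq {A : Type*} [AddCommMonoid A] {n : ℕ} [NeZero n]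
    (f : DihedralGroup n → A) : ∑ g, f g = ∑ i, f (.r i) + ∑ i, f (.sr i) := by
  rw [← DihedralGroup.equivSum.symm.sum_comp, Fintype.sum_sum_type]
  rfl

theorem ZMod.exists_fin_half {n : ℕ} [NeZero n] (hn : Odd n) {j : ZMod n} (hj : j ≠ 0) :
    ∃ t : Fin ((n - 1) / 2), j = ((t : ℕ) + 1 : ℕ) ∨ j = -((t : ℕ) + 1 : ℕ) := by
  obtain ⟨m, hm⟩ := hn
  have hpos : 0 < j.val := Nat.pos_of_ne_zero fun h => hj ((ZMod.val_eq_zero j).mp h)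
  have hlt : j.val < n := j.val_lt
  by_cases h : j.val ≤ m
  · refine ⟨⟨j.val - 1, by omega⟩, .inl ?_⟩
    rw [show j.val - 1 + 1 = j.val by omega, ZMod.natCast_rightInverse j]
  · refine ⟨⟨n - j.val - 1, by omega⟩, .inr ?_⟩
    rw [show n - j.val - 1 + 1 = n - j.val by omega, Nat.cast_sub hlt.le]
    simp

open Polynomial in
/-- For `n` odd the group algebra of the dihedral group of order `2n` over an algebraically closed
field of characteristic two is a product of the dual numbers and copies of `M₂(k)`. -/
theorem DihedralGroup.nonempty_monoidAlgebra_algEquiv (k : Type*) [Field k] [IsAlgClosed k]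
    [CharP k 2] (n : ℕ) (hn : Odd n) :
    Nonempty (MonoidAlgebra k (DihedralGroup n) ≃ₐ[k]
        ((k[X] ⧸ Ideal.span ({X ^ 2} : Set k[X])) ×
          (Fin ((n - 1) / 2) → Matrix (Fin 2) (Fin 2) k))) := by
  have hnk : (n : k) ≠ 0 := by
    rw [Ne, CharP.cast_eq_zero_iff k 2]
    exact hn.not_two_dvd_nat
  have : NeZero (n : k) := ⟨hnk⟩
  have : NeZero n := .of_neZero_natCast k
  obtain ⟨ζ, hζ⟩ := HasEnoughRootsOfUnity.exists_primitiveRoot k n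
  let ψ : AddChar (ZMod n) k := AddChar.zmodChar n hζ.pow_eq_one
  have hψ : ψ.IsPrimitive := AddChar.zmodChar_primitive_of_primitive_root n hζ
  let q : k[X] →ₐ[k] (k[X] ⧸ Ideal.span ({X ^ 2} : Set k[X])) := Ideal.Quotient.mkₐ k _
  have hq (p : k[X]) : q p = 0 ↔ X ^ 2 ∣ p := by
    rw [← Ideal.mem_span_singleton]
    exact Ideal.Quotient.eq_zero_iff_mem
  have hu : q (1 + X) * q (1 + X) = 1 := by
    rw [← map_mul, ← map_one q, ← sub_eq_zero, ← map_sub, hq]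
    refine ⟨1, ?_⟩
    have h2 : (2 : k[X]) = 0 := CharTwo.two_eq_zero
    linear_combination X * h2
  let ρ := (DihedralGroup.involutionHom n _ hu).prod
    (MonoidHom.pi fun t : Fin ((n - 1) / 2) =>
      DihedralGroup.matrixRep (ψ.mulShift ((t : ℕ) + 1 : ℕ)))
  let Φ := MonoidAlgebra.lift k _ _ ρ
  have hΦ (f) : Φ f = ∑ g, f.coeff g • ρ g := by
    rw [MonoidAlgebra.lift_apply, Finsupp.sum_fintype _ _ (by simp)]
  have hρr (i) : (ρ (.r i)).1 = 1 := rfl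
  have hρsr (i) : (ρ (.sr i)).1 = q (1 + X) := rfl
  have hρr' (i t) : (ρ (.r i)).2 t =
      DihedralGroup.matrixRep (ψ.mulShift ((t : ℕ) + 1 : ℕ)) (.r i) := rfl
  have hρsr' (i t) : (ρ (.sr i)).2 t =
      DihedralGroup.matrixRep (ψ.mulShift ((t : ℕ) + 1 : ℕ)) (.sr i) := rfl
  have hinj : Function.Injective Φ := by
    rw [injective_iff_map_eq_zero]
    intro f hf
    rw [hΦ, DihedralGroup.sum_eq] at hf
    have h1 := congrArg Prod.fst hf
    have h2 (t) := congrFun (congrArg Prod.snd hf) t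
    have hzero : ∑ i, f.coeff (.r i) = 0 ∧ ∑ i, f.coeff (.sr i) = 0 := by
      have h3 : q (C (∑ i, f.coeff (.r i)) + C (∑ i, f.coeff (.sr i)) * (1 + X)) = 0 := by
        simp only [Prod.fst_add, Prod.fst_sum, Prod.smul_fst, hρr, hρsr, Prod.fst_zero,
          ← Finset.sum_smul] at h1
        rw [← h1, ← smul_eq_C_mul, map_add, map_smul, ← mul_one (C _), ← smul_eq_C_mul, map_smul,
          map_one]
      rw [hq, X_pow_dvd_iff] at h3
      have h4 := h3 0 (by norm_num)
      have h5 := h3 1 (by norm_num)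
      simp [mul_add, coeff_X] at h4 h5
      exact ⟨by simpa [h5] using h4, h5⟩
    have hr (t : Fin ((n - 1) / 2)) :
        (∑ i, f.coeff (.r i) * ψ (((t : ℕ) + 1 : ℕ) * i) = 0 ∧
         ∑ i, f.coeff (.r i) * ψ (-((t : ℕ) + 1 : ℕ) * i) = 0) ∧
        (∑ i, f.coeff (.sr i) * ψ (((t : ℕ) + 1 : ℕ) * i) = 0 ∧
         ∑ i, f.coeff (.sr i) * ψ (-((t : ℕ) + 1 : ℕ) * i) = 0) := by
      have h00 := congrFun (congrFun (h2 t) 0) 0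
      have h01 := congrFun (congrFun (h2 t) 0) 1
      have h10 := congrFun (congrFun (h2 t) 1) 0
      have h11 := congrFun (congrFun (h2 t) 1) 1
      simp only [Prod.snd_add, Prod.snd_sum, Prod.smul_snd, Pi.add_apply, Finset.sum_apply,
        Pi.smul_apply, hρr', hρsr', Matrix.add_apply, Matrix.sum_apply, Matrix.smul_apply,
        Prod.snd_zero, Pi.zero_apply, Matrix.zero_apply, DihedralGroup.matrixRep, MonoidHom.coe_mk,
        OneHom.coe_mk, AddChar.mulShift_apply, Matrix.of_apply, Matrix.cons_val_zero,
        Matrix.cons_val_one, smul_eq_mul, mul_zero, Finset.sum_const_zero, add_zero, zero_add,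
        Matrix.cons_val', Matrix.cons_val_fin_one, mul_neg, ← neg_mul] at h00 h01 h10 h11
      exact ⟨⟨h00, h11⟩, h10, h01⟩
    have hrz : (fun i => f.coeff (.r i)) = 0 := by
      refine AddChar.eq_zero_of_forall_sum_mul_eq_zero hnk hψ fun j => ?_
      by_cases hj : j = 0
      · simpa [hj] using hzero.1
      · obtain ⟨t, rfl | rfl⟩ := ZMod.exists_fin_half hn hj
        exacts [(hr t).1.1, (hr t).1.2]
    have hsrz : (fun i => f.coeff (.sr i)) = 0 := by
      refine AddChar.eq_zero_of_forall_sum_mul_eq_zero hnk hψ fun j => ?_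
      by_cases hj : j = 0
      · simpa [hj] using hzero.2
      · obtain ⟨t, rfl | rfl⟩ := ZMod.exists_fin_half hn hj
        exacts [(hr t).2.1, (hr t).2.2]
    ext (i | i)
    exacts [congrFun hrz i, congrFun hsrz i]
  have hX : (X ^ 2 : k[X]) ≠ 0 := pow_ne_zero 2 X_ne_zero
  have : Module.Finite k (k[X] ⧸ Ideal.span ({X ^ 2} : Set k[X])) :=
    (AdjoinRoot.powerBasis hX).finite
  have hrank : Module.finrank k (MonoidAlgebra k (DihedralGroup n)) =
      Module.finrank k ((k[X] ⧸ Ideal.span ({X ^ 2} : Set k[X])) ×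
          (Fin ((n - 1) / 2) → Matrix (Fin 2) (Fin 2) k)) := by
    obtain ⟨m, rfl⟩ := hn
    rw [Module.finrank_prod, finrank_quotient_span_eq_natDegree, Module.finrank_pi_fintype,
      (MonoidAlgebra.coeffLinearEquiv k).finrank_eq, Module.finrank_finsupp_self,
      DihedralGroup.card]
    simp [Module.finrank_matrix]
    omega
  have : Module.Finite k (MonoidAlgebra k (DihedralGroup n)) :=
    .equiv (MonoidAlgebra.coeffLinearEquiv k).symm
  exact ⟨AlgEquiv.ofBijective Φ ⟨hinj,
    (LinearMap.injective_iff_surjective_of_finrank_eq_finrank hrank (f := Φ.toLinearMap)).mp hinj⟩⟩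

/-- Multiplication by a central element as an endomorphism. -/
def centralSMul {Λ : Type*} [Ring Λ] {c : Λ} (hc : ∀ x, Commute c x) (M : Type*) [AddCommGroup M]
    [Module Λ M] : M →ₗ[Λ] M where
  toFun m := c • m
  map_add' := smul_add c
  map_smul' x m := by simp [smul_smul, (hc x).eq]

@[simp]
theorem centralSMul_apply {Λ : Type*} [Ring Λ] {c : Λ} (hc : ∀ x, Commute c x) {M : Type*}
    [AddCommGroup M] [Module Λ M] (m : M) : centralSMul hc M m = c • m := rfl

theorem smul_eq_of_mem_range_centralSMul {Λ : Type*} [Ring Λ] {c : Λ} (hc : ∀ x, Commute c x)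
    (hcc : IsIdempotentElem c) {M : Type*} [AddCommGroup M] [Module Λ M] {m : M}
    (hm : m ∈ LinearMap.range (centralSMul hc M)) : c • m = m := by
  obtain ⟨y, rfl⟩ := hm
  simp [smul_smul, hcc.eq]

theorem projective_range_centralSMul {Λ : Type*} [Ring Λ] {c : Λ} (hc : ∀ x, Commute c x)
    (hcc : IsIdempotentElem c) (M : Type*) [AddCommGroup M] [Module Λ M] [Module.Projective Λ M] :
    Module.Projective Λ (LinearMap.range (centralSMul hc M)) := by
  refine Module.Projective.of_split (LinearMap.range (centralSMul hc M)).subtype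
    (centralSMul hc M).rangeRestrict ?_
  ext ⟨m, hm⟩
  exact smul_eq_of_mem_range_centralSMul hc hcc hm

theorem isSuperfluous_of_le_range_centralSMul {Λ : Type*} [Ring Λ] {s : Λ}
    (hs : ∀ x, Commute s x) (hss : s * s = 0) {P : Type*} [AddCommGroup P] [Module Λ P]
    {N : Submodule Λ P} (hN : N ≤ LinearMap.range (centralSMul hs P)) : IsSuperfluous Λ N := by
  intro K hK
  have hdec (x : P) : ∃ a ∈ K, ∃ y, a + s • y = x := by
    obtain ⟨a, ha, b, hb, rfl⟩ := Submodule.mem_sup.mp (hK ▸ Submodule.mem_top : x ∈ K ⊔ N)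
    obtain ⟨y, rfl⟩ := hN hb
    exact ⟨a, ha, y, rfl⟩
  refine eq_top_iff.mpr fun x _ => ?_
  obtain ⟨a, ha, y, rfl⟩ := hdec x
  obtain ⟨b, hb, z, rfl⟩ := hdec y
  rw [smul_add, smul_smul, hss, zero_smul, add_zero]
  exact K.add_mem ha (K.smul_mem s hb)

/-- The central elements `e` and `s` of `Λ` exhibit `Λ` as the product of the dual numbers
`Λe = ke + ks` over `k` and a semisimple ring. -/
structure IsDualNumberBlock (k : Type*) {Λ : Type*} [Field k] [Ring Λ] [Algebra k Λ]
    (e s : Λ) : Prop where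
  commute_left : ∀ x, Commute e x
  commute_right : ∀ x, Commute s x
  idem : IsIdempotentElem e
  mul_eq : e * s = s
  sq_zero : s * s = 0
  exists_eq : ∀ x, ∃ a b : k, e * x = a • e + b • s
  semisimple : ∀ (X : Type) [AddCommGroup X] [Module Λ X],
    (∀ x : X, s • x = 0) → IsSemisimpleModule Λ X

namespace IsDualNumberBlock

variable {k Λ : Type} [Field k] [Ring Λ] [Algebra k Λ] {e s : Λ}

theorem commute_compl (h : IsDualNumberBlock k e s) (x : Λ) : Commute (1 - e) x :=
  (Commute.one_left x).sub_left (h.commute_left x)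

/-- A module over the block `Λe` has a projective cover that is free over `Λe`. -/
theorem exists_cover (h : IsDualNumberBlock k e s) {N : Type} [AddCommGroup N] [Module Λ N]
    (hN : ∀ x : N, e • x = x) :
    ∃ (J : Type) (f : LinearMap.range (centralSMul h.commute_left (J →₀ Λ)) →ₗ[Λ] N),
      Function.Surjective f ∧ LinearMap.ker f ≤ LinearMap.range (centralSMul h.commute_right
        (LinearMap.range (centralSMul h.commute_left (J →₀ Λ)))) := by
  let sN := LinearMap.range (centralSMul h.commute_right N)
  let V := N ⧸ sN
  let _ : Module k V := Module.compHom V (algebraMap k Λ)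
  have hkV (a : k) (x : V) : a • x = algebraMap k Λ a • x := rfl
  let B := Module.Basis.ofVectorSpace k V
  choose v hv using fun j => sN.mkQ_surjective (B j)
  let Q := LinearMap.range (centralSMul h.commute_left (Module.Basis.ofVectorSpaceIndex k V →₀ Λ))
  let f := (Finsupp.linearCombination Λ v).comp Q.subtype
  refine ⟨_, f, ?_, ?_⟩
  · rw [← LinearMap.range_eq_top]
    refine isSuperfluous_of_le_range_centralSMul h.commute_right h.sq_zero le_rfl _ ?_
    refine eq_top_iff.mpr fun x _ => ?_
    let p := (B.repr (sN.mkQ x)).mapRange (algebraMap k Λ) (map_zero _)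
    have hp : sN.mkQ (Finsupp.linearCombination Λ v p) = sN.mkQ x := by
      conv_rhs => rw [← B.linearCombination_repr (sN.mkQ x)]
      rw [Finsupp.linearCombination_apply, Finsupp.sum_mapRange_index (by simp), Finsupp.sum,
        map_sum, Finsupp.linearCombination_apply, Finsupp.sum]
      simp only [map_smul, hv, hkV]
    have hfp : f ⟨e • p, p, rfl⟩ = Finsupp.linearCombination Λ v p := by
      rw [← hN (Finsupp.linearCombination Λ v p), ← map_smul]
      rfl
    rw [← add_sub_cancel (Finsupp.linearCombination Λ v p) x]
    refine Submodule.add_mem_sup ⟨_, hfp⟩ ?_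
    exact (Submodule.Quotient.eq sN).mp hp.symm
  · rintro ⟨p, hp⟩ hfp
    have hfp' : ∑ j ∈ p.support, p j • v j = 0 := hfp
    have hep : e • p = p := smul_eq_of_mem_range_centralSMul h.commute_left h.idem hp
    choose a b hab using fun j => h.exists_eq (p j)
    have hpj (j) : p j = a j • e + b j • s := by
      rw [← hab, ← smul_eq_mul, ← Finsupp.smul_apply, hep]
    have hmk (j) : sN.mkQ (p j • v j) = a j • B j := by
      have hsv : sN.mkQ ((b j • s) • v j) = 0 := by
        refine (Submodule.Quotient.mk_eq_zero sN).mpr ⟨algebraMap k Λ (b j) • v j, ?_⟩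
        rw [centralSMul_apply, smul_smul, Algebra.smul_def, (h.commute_right _).eq]
      rw [hpj, add_smul, map_add, hsv, add_zero, Algebra.smul_def, mul_smul, hN, map_smul, hv, hkV]
    have hsum : ∑ j ∈ p.support, a j • B j = 0 := by
      simpa only [map_sum, map_zero, hmk] using congrArg sN.mkQ hfp'
    have ha := linearIndependent_iff'.mp B.linearIndependent _ _ hsum
    refine ⟨⟨e • ∑ j ∈ p.support, Finsupp.single j (algebraMap k Λ (b j)), _, rfl⟩,
      Subtype.ext ?_⟩
    change s • e • _ = p
    rw [smul_smul, ← (h.commute_left s).eq, h.mul_eq, Finset.smul_sum]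
    conv_rhs => rw [← Finsupp.sum_single p]
    refine Finset.sum_congr rfl fun j hj => ?_
    rw [Finsupp.smul_single, smul_eq_mul, hpj, ha j hj, zero_smul, zero_add, Algebra.smul_def,
      (h.commute_right _).eq]

theorem projective_of_smul_eq_zero (h : IsDualNumberBlock k e s) {N : Type} [AddCommGroup N]
    [Module Λ N] (hN : ∀ x : N, e • x = 0) : Module.Projective Λ N := by
  have hidem := h.idem.one_sub
  let Q := LinearMap.range (centralSMul h.commute_compl (N →₀ Λ))
  have : Module.Projective Λ Q := projective_range_centralSMul _ hidem _
  have hQ (x : Q) : s • x = 0 := by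
    have hx : (1 - e) • x = x :=
      Subtype.ext (smul_eq_of_mem_range_centralSMul h.commute_compl hidem x.2)
    rw [← hx, smul_smul, mul_sub, mul_one, ← (h.commute_left s).eq, h.mul_eq, sub_self, zero_smul]
  have := h.semisimple Q hQ
  let g : Q →ₗ[Λ] N := (Finsupp.linearCombination Λ id).comp Q.subtype
  have hg : Function.Surjective g := fun x =>
    ⟨⟨(1 - e) • Finsupp.single x 1, _, rfl⟩, by simp [g, sub_smul, hN]⟩
  obtain ⟨i, hi⟩ := IsSemisimpleModule.lifting_property (R := Λ) (M := Q) (N := N) g hg LinearMap.id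
  exact Module.Projective.of_split i g hi

/-- A projective cover of a τ-rigid module is injective: otherwise the kernel contains a nonzero
element `s • y`, and lifting maps along the presentation forces `e` to annihilate the module. -/
theorem injective_of_isTauRigid (h : IsDualNumberBlock k e s) {M P : Type} [AddCommGroup M]
    [Module Λ M] (hM : IsTauRigid Λ M) [AddCommGroup P] [Module Λ P] [Module.Projective Λ P]
    (g : P →ₗ[Λ] M) (hg : Function.Surjective g)
    (hker : LinearMap.ker g ≤ LinearMap.range (centralSMul h.commute_right P)) :
    Function.Injective g := by
  let K := LinearMap.ker g
  have hK (x : K) : e • x = x := by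
    obtain ⟨y, hy⟩ := hker x.2
    refine Subtype.ext ?_
    rw [Submodule.coe_smul, ← hy, centralSMul_apply, smul_smul, h.mul_eq]
  obtain ⟨J', f₁, hf₁, hk₁⟩ := h.exists_cover (N := K) hK
  let P₁ := LinearMap.range (centralSMul h.commute_left (J' →₀ Λ))
  have := projective_range_centralSMul h.commute_left h.idem (J' →₀ Λ)
  let f := K.subtype.comp f₁
  have hf : LinearMap.ker f = LinearMap.ker f₁ := LinearMap.ker_comp_of_ker_eq_bot _ K.ker_subtype
  have hsurj := hM P₁ _ inferInstance inferInstance f g hg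
    (by rw [LinearMap.range_comp, LinearMap.range_eq_top.mpr hf₁, Submodule.map_top,
      Submodule.range_subtype])
    (isSuperfluous_of_le_range_centralSMul h.commute_right h.sq_zero hker)
    (isSuperfluous_of_le_range_centralSMul h.commute_right h.sq_zero (hf ▸ hk₁))
  have hbot : K = ⊥ := by
    rcases isEmpty_or_nonempty J' with hJ | ⟨⟨j⟩⟩
    · refine (Submodule.eq_bot_iff _).mpr fun x hx => ?_
      obtain ⟨p, hp⟩ := hf₁ ⟨x, hx⟩
      rw [Subsingleton.elim p 0, map_zero] at hp
      exact (congrArg Subtype.val hp).symm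
    · have hmem (m : M) : ∃ w : M, e • m = s • w := by
        obtain ⟨t, ht⟩ := hsurj ((Finsupp.linearCombination Λ fun _ => e • m).comp P₁.subtype)
        let p : P₁ := ⟨e • Finsupp.single j 1, _, rfl⟩
        have hp : t (f p) = e • m := by
          simpa [p, smul_smul, h.idem.eq] using LinearMap.congr_fun ht p
        obtain ⟨y, hy⟩ := hker (f₁ p).2
        have hy' : s • y = f p := hy
        exact ⟨t y, by rw [← hp, ← hy', map_smul]⟩
      have heM_zero (m : M) : e • m = 0 := by
        obtain ⟨w, hw⟩ := hmem m
        obtain ⟨u, hu⟩ := hmem w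
        rw [hw, ← h.mul_eq, (h.commute_left s).eq, mul_smul, hu, smul_smul, h.sq_zero, zero_smul]
      refine (Submodule.eq_bot_iff _).mpr fun x hx => ?_
      obtain ⟨y, rfl⟩ := hker hx
      have hey : e • y ∈ K := by simp [K, heM_zero]
      obtain ⟨z, hz⟩ := hker hey
      rw [centralSMul_apply, ← h.mul_eq, (h.commute_left s).eq, mul_smul, ← hz, centralSMul_apply,
        smul_smul, h.sq_zero, zero_smul]
  exact LinearMap.ker_eq_bot.mp hbot

theorem exists_projective_cover (h : IsDualNumberBlock k e s) {N : Type} [AddCommGroup N]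
    [Module Λ N] (hN : ∀ x : N, e • x = x) :
    ∃ (P : Type) (_ : AddCommGroup P) (_ : Module Λ P) (f : P →ₗ[Λ] N), Module.Projective Λ P ∧
      Function.Surjective f ∧
      LinearMap.ker f ≤ LinearMap.range (centralSMul h.commute_right P) := by
  obtain ⟨J, f, hf, hk⟩ := h.exists_cover hN
  refine ⟨LinearMap.range (centralSMul h.commute_left (J →₀ Λ)), inferInstance, inferInstance, f,
    ?_, hf, hk⟩
  exact projective_range_centralSMul h.commute_left h.idem (J →₀ Λ)

theorem projective_of_isTauRigid (h : IsDualNumberBlock k e s) {M : Type} [AddCommGroup M]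
    [Module Λ M] (hM : IsTauRigid Λ M) : Module.Projective Λ M := by
  let eM := LinearMap.range (centralSMul h.commute_left M)
  let cM := LinearMap.range (centralSMul h.commute_compl M)
  have hcM (x : cM) : e • (x : M) = 0 := by
    obtain ⟨y, hy⟩ := x.2
    rw [← hy, centralSMul_apply, smul_smul, mul_sub, mul_one, h.idem.eq, sub_self, zero_smul]
  have heM (x : eM) : e • (x : M) = x := smul_eq_of_mem_range_centralSMul h.commute_left h.idem x.2
  have hcproj : Module.Projective Λ cM :=
    h.projective_of_smul_eq_zero fun x => Subtype.ext (hcM x)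
  obtain ⟨P, _, _, f₀, _, hf₀, hk₀⟩ :=
    h.exists_projective_cover (N := eM) fun x => Subtype.ext (heM x)
  let g : P × cM →ₗ[Λ] M := (eM.subtype.comp f₀).coprod cM.subtype
  have hg : Function.Surjective g := by
    intro x
    obtain ⟨p, hp⟩ := hf₀ ⟨e • x, x, rfl⟩
    refine ⟨(p, ⟨(1 - e) • x, x, rfl⟩), ?_⟩
    rw [LinearMap.coprod_apply, LinearMap.comp_apply, hp]
    simp [sub_smul]
  have hker : LinearMap.ker g ≤ LinearMap.range (centralSMul h.commute_right (P × cM)) := by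
    rintro ⟨p, m⟩ hpm
    have hpm' : (f₀ p : M) + m = 0 := hpm
    have hp : (f₀ p : M) = 0 := by
      simpa [smul_add, heM, hcM] using congrArg (e • ·) hpm'
    obtain ⟨q, hq⟩ := hk₀ (LinearMap.mem_ker.mpr (Subtype.ext hp))
    refine ⟨(q, 0), Prod.ext hq ?_⟩
    rw [hp, zero_add] at hpm'
    simpa using (Subtype.ext hpm' : m = 0).symm
  exact Module.Projective.of_equiv'
    (LinearEquiv.ofBijective g ⟨h.injective_of_isTauRigid hM g hg hker, hg⟩)

theorem isSemisimpleModule_of_isSemibrick (h : IsDualNumberBlock k e s) {S : Type}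
    [AddCommGroup S] [Module Λ S] (hS : IsSemibrick k Λ S) : IsSemisimpleModule Λ S := by
  obtain ⟨t, X, -, hX, hbrick, -⟩ := hS
  refine isSemisimpleModule_of_isSemisimpleModule_submodule' (fun i => ?_) hX
  obtain ⟨φ⟩ := hbrick i
  refine h.semisimple _ fun x => ?_
  have hsq : centralSMul h.commute_right (X i) * centralSMul h.commute_right (X i) = 0 := by
    ext x
    simp [smul_smul, h.sq_zero]
  have hφ := congrArg φ hsq
  rw [map_mul, map_zero, mul_self_eq_zero, map_eq_zero_iff φ φ.injective] at hφ
  exact LinearMap.congr_fun hφ x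

end IsDualNumberBlock

theorem exists_isDualNumberBlock {k Λ A B : Type} [Field k] [Ring Λ] [Algebra k Λ] [CommRing A]
    [Algebra k A] [Ring B] [Algebra k B] [IsSemisimpleRing B] (φ : Λ ≃ₐ[k] A × B) {x : A}
    (hxx : x * x = 0) (hdec : ∀ a : A, ∃ c d : k, a = c • 1 + d • x) (ε : A →ₐ[k] k)
    (hεx : ε x = 0) : ∃ e s : Λ, IsDualNumberBlock k e s := by
  refine ⟨φ.symm (1, 0), φ.symm (x, 0), ?_, ?_, ?_, ?_, ?_, ?_, ?_⟩
  · exact fun x => φ.injective (Prod.ext (by simp) (by simp))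
  · exact fun x => φ.injective (Prod.ext (by simp [mul_comm]) (by simp))
  · exact φ.injective (by simp)
  · exact φ.injective (by simp)
  · exact φ.injective (by simp [hxx])
  · intro y
    obtain ⟨c, d, hy⟩ := hdec (φ y).1
    exact ⟨c, d, φ.injective (Prod.ext (by simp [hy]) (by simp))⟩
  · intro M _ _ hM
    let π : Λ →+* k × B := (RingHom.prodMap ε.toRingHom (RingHom.id B)).comp φ.toRingEquiv.toRingHom
    have hπ : Function.Surjective π := by
      rintro ⟨a, b⟩
      exact ⟨φ.symm (algebraMap k A a, b), by simp [π]⟩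
    have : IsSemisimpleRing (Λ ⧸ RingHom.ker π) :=
      (RingHom.quotientKerEquivOfSurjective hπ).symm.isSemisimpleRing
    have htors : Module.IsTorsionBySet Λ M (RingHom.ker π) := by
      rintro m ⟨y, hy⟩
      obtain ⟨c, d, hcd⟩ := hdec (φ y).1
      have hc : ε (φ y).1 = 0 := congrArg Prod.fst hy
      have hy₂ : (φ y).2 = 0 := congrArg Prod.snd hy
      rw [hcd, map_add, map_smul, map_smul, hεx, smul_zero, add_zero, map_one, smul_eq_mul,
        mul_one] at hc
      have hyx : y = algebraMap k Λ d * φ.symm (x, 0) :=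
        φ.injective (Prod.ext (by simp [hcd, hc, Algebra.smul_def]) (by simp [hy₂]))
      change y • m = 0
      rw [hyx, mul_smul, hM, smul_zero]
    let _ := htors.module
    exact htors.isSemisimpleModule_iff.mp inferInstance

open Polynomial in
theorem exists_isDualNumberBlock_of_algEquiv {k Λ B : Type} [Field k] [Ring Λ] [Algebra k Λ]
    [Ring B] [Algebra k B] [IsSemisimpleRing B]
    (φ : Λ ≃ₐ[k] ((k[X] ⧸ Ideal.span ({X ^ 2} : Set k[X])) × B)) :
    ∃ e s : Λ, IsDualNumberBlock k e s := by
  have hq (p : k[X]) : Ideal.Quotient.mkₐ k (Ideal.span ({X ^ 2} : Set k[X])) p = 0 ↔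
      X ^ 2 ∣ p := by
    rw [← Ideal.mem_span_singleton]
    exact Ideal.Quotient.eq_zero_iff_mem
  refine exists_isDualNumberBlock φ (x := Ideal.Quotient.mkₐ k _ X) ?_ (fun a => ?_)
    (Ideal.Quotient.liftₐ _ (aeval 0) fun p hp => ?_) ?_
  · rw [← map_mul, hq, sq]
  · obtain ⟨p, rfl⟩ := Ideal.Quotient.mkₐ_surjective k _ a
    refine ⟨p.coeff 0, p.coeff 1, ?_⟩
    rw [← map_one (Ideal.Quotient.mkₐ k _), ← map_smul, ← map_smul, ← map_add, ← sub_eq_zero,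
      ← map_sub, hq, X_pow_dvd_iff]
    intro d hd
    interval_cases d <;> simp [coeff_X, coeff_one]
  · obtain ⟨r, rfl⟩ := Ideal.mem_span_singleton.mp hp
    simp
  · simp

open Polynomial in
/-- Let `k` be an (algebraically closed) field of characteristic `2`
and `D_{2n}` the dihedral group of order `2n` with `n` odd.  Then
`kD_{2n} ≅ k[x]/(x²) × M₂(k)^{(n−1)/2}` as `k`-algebras; in particular every support
τ-tilting `kD_{2n}`-module is projective and every semibrick over `kD_{2n}` is
semisimple. -/
theorem stmt_19 (k : Type) [Field k] [IsAlgClosed k] [CharP k 2]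
    (n : ℕ) (hn : Odd n) :
    Nonempty (MonoidAlgebra k (DihedralGroup n) ≃ₐ[k]
        ((k[X] ⧸ Ideal.span ({X ^ 2} : Set k[X])) ×
          (Fin ((n - 1) / 2) → Matrix (Fin 2) (Fin 2) k))) ∧
    (∀ (M : Type) [AddCommGroup M] [Module (MonoidAlgebra k (DihedralGroup n)) M],
      IsSupportTauTilting (MonoidAlgebra k (DihedralGroup n)) M →
        Module.Projective (MonoidAlgebra k (DihedralGroup n)) M) ∧
    (∀ (S : Type) [AddCommGroup S] [Module (MonoidAlgebra k (DihedralGroup n)) S],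
      IsSemibrick k (MonoidAlgebra k (DihedralGroup n)) S →
        IsSemisimpleModule (MonoidAlgebra k (DihedralGroup n)) S) := by
  obtain ⟨φ⟩ := DihedralGroup.nonempty_monoidAlgebra_algEquiv k n hn
  obtain ⟨e, s, h⟩ := exists_isDualNumberBlock_of_algEquiv φ
  exact ⟨⟨φ⟩, fun M _ _ hM => h.projective_of_isTauRigid hM.1,
    fun S _ _ hS => h.isSemisimpleModule_of_isSemibrick hS⟩
end
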